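/- The spectral-parameter-dependent R-matrix R̄ of type C_n^{(1)} satisfies the quantum Yang–Baxter equation: R̄_{12}(z)·R̄_{13}(zw)·R̄_{23}(w) = R̄_{23}(w)·R̄_{13}(zw)·R̄_{12}(z), where for a 4n²×4n² matrix X one sets X_{12} = X⊗I, X_{23} = I⊗X, and X_{13} = (I⊗P)(X⊗I)(I⊗P) with P = Σ_{i,j=1}^{2n}E_{ij}⊗E_{ji} the permutation matrix, all products being 8n³×8n³ matrices. -/

import Mathlib

noncomputable section

open Finset
open scoped Kronecker

set_option maxHeartbeats 1000000

abbrev K : Type := FractionRing (MvPolynomial (Fin 4) ℚ)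

def ρ : K := algebraMap (MvPolynomial (Fin 4) ℚ) K (MvPolynomial.X 0)
def σ' : K := algebraMap (MvPolynomial (Fin 4) ℚ) K (MvPolynomial.X 1)
def r : K := ρ ^ 2
def s : K := σ' ^ 2
def zVar : K := algebraMap (MvPolynomial (Fin 4) ℚ) K (MvPolynomial.X 2)
def wVar : K := algebraMap (MvPolynomial (Fin 4) ℚ) K (MvPolynomial.X 3)

abbrev M (n : ℕ) := Matrix (Fin (2*n)) (Fin (2*n)) K
abbrev M2 (n : ℕ) := Matrix (Fin (2*n) × Fin (2*n)) (Fin (2*n) × Fin (2*n)) K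

/-- the matrix unit `E_{kl}` (1-based indices). -/
def E (n k l : ℕ) : M n :=
  Matrix.of fun a b => if a.val + 1 = k ∧ b.val + 1 = l then (1 : K) else 0

def eMat (n i : ℕ) : M n :=
  if i = n then (ρ⁻¹ * σ'⁻¹) • E n (n+1) n
  else (ρ⁻¹ * σ'⁻¹) • E n (i+1) i - E n (2*n-i+1) (2*n-i)

def fMat (n i : ℕ) : M n :=
  if i = n then (ρ⁻¹ * σ'⁻¹) • E n n (n+1)
  else (ρ⁻¹ * σ'⁻¹) • E n i (i+1) - E n (2*n-i) (2*n-i+1)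

def ωMat (n i : ℕ) : M n :=
  if i = n then
    ∑ j ∈ Icc 1 (2*n),
      (if j ≤ n - 1 then r * s else if j = n then r⁻¹ * s else if j = n + 1 then r * s⁻¹
       else r⁻¹ * s⁻¹) • E n j j
  else
    ∑ j ∈ Icc 1 (2*n),
      (if j = i then r⁻¹ else if j = i + 1 then s⁻¹ else if j = 2*n - i then s
       else if j = 2*n - i + 1 then r else 1) • E n j j

def ω'Mat (n i : ℕ) : M n :=
  if i = n then
    ∑ j ∈ Icc 1 (2*n),
      (if j ≤ n - 1 then r * s else if j = n then r * s⁻¹ else if j = n + 1 then r⁻¹ * s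
       else r⁻¹ * s⁻¹) • E n j j
  else
    ∑ j ∈ Icc 1 (2*n),
      (if j = i then s⁻¹ else if j = i + 1 then r⁻¹ else if j = 2*n - i then r
       else if j = 2*n - i + 1 then s else 1) • E n j j

/-- `ī` for `1 ≤ i ≤ 2n`. -/
def bar (n i : ℕ) : ℤ := if i ≤ n then (n : ℤ) + 1 - i else (n : ℤ) - i

/-- `ε_i` for `1 ≤ i ≤ 2n`. -/
def sg (n i : ℕ) : K := if i ≤ n then 1 else -1

def S1 (n : ℕ) : M2 n :=
  (∑ i ∈ Icc 1 (n-1), ∑ j ∈ Icc (i+1) n, E n i i ⊗ₖ E n j j)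
  + (∑ i ∈ Icc 1 (n-1), ∑ j ∈ Icc (2*n+1-i+1) (2*n), E n i i ⊗ₖ E n j j)
  + (∑ j ∈ Icc (n+2) (2*n), E n n n ⊗ₖ E n j j)
  + (∑ j ∈ Icc (n+1) (2*n-1), ∑ i ∈ Icc (j+1) (2*n), E n i i ⊗ₖ E n j j)
  + (∑ i ∈ Icc 1 (n-1), ∑ j ∈ Icc (n+1) (2*n-i), E n j j ⊗ₖ E n i i)

def S2 (n : ℕ) : M2 n :=
  (∑ i ∈ Icc 1 (n-1), ∑ j ∈ Icc (i+1) n, E n j j ⊗ₖ E n i i)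
  + (∑ i ∈ Icc 1 (n-1), ∑ j ∈ Icc (2*n+1-i+1) (2*n), E n j j ⊗ₖ E n i i)
  + (∑ j ∈ Icc (n+2) (2*n), E n j j ⊗ₖ E n n n)
  + (∑ j ∈ Icc (n+1) (2*n-1), ∑ i ∈ Icc (j+1) (2*n), E n j j ⊗ₖ E n i i)
  + (∑ i ∈ Icc 1 (n-1), ∑ j ∈ Icc (n+1) (2*n-i), E n i i ⊗ₖ E n j j)

/-- The basic quantum `R`-matrix of type `C_n`. -/
def RMat (n : ℕ) : M2 n :=
  (ρ * σ'⁻¹) • (∑ i ∈ Icc 1 (2*n), E n i i ⊗ₖ E n i i)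
  + (ρ⁻¹ * σ') • (∑ i ∈ Icc 1 (2*n), E n i i ⊗ₖ E n (2*n+1-i) (2*n+1-i))
  + (ρ * σ') • S1 n
  + (ρ⁻¹ * σ'⁻¹) • S2 n
  + (ρ * σ'⁻¹ - ρ⁻¹ * σ') •
      ((∑ i ∈ Icc 1 (2*n), ∑ j ∈ Icc (i+1) (2*n), E n i j ⊗ₖ E n j i)
        - ∑ i ∈ Icc 1 (2*n), ∑ j ∈ Icc 1 (i-1),
            ((ρ * σ'⁻¹) ^ (bar n i - bar n j) * sg n i * sg n j) •
              (E n (2*n+1-i) (2*n+1-j) ⊗ₖ E n i j))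

/-- The permutation matrix `P`. -/
def Pmat (n : ℕ) : M2 n := ∑ i ∈ Icc 1 (2*n), ∑ j ∈ Icc 1 (2*n), E n i j ⊗ₖ E n j i

def nExp (n : ℕ) : K := r ^ (-(n : ℤ) - 1) * s ^ ((n : ℤ) + 1)

/-- coefficients `a_{ij}(z)`. -/
def aC (n : ℕ) (z : K) (i j : ℕ) : K :=
  if i = j then (z - 1) * (r⁻¹ * s * z - nExp n)
  else if j < i then
    (r⁻¹ * s - 1) * z * ((ρ * σ'⁻¹) ^ (bar n i - bar n j) * sg n i * sg n j * (z - 1)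
      - (if i = 2*n + 1 - j then 1 else 0) * (z - nExp n))
  else
    (r⁻¹ * s - 1) * ((ρ * σ'⁻¹) ^ (bar n i - bar n j) * sg n i * sg n j * nExp n * (z - 1)
      - (if i = 2*n + 1 - j then 1 else 0) * (z - nExp n))

/-- The spectral-parameter-dependent `R`-matrix of type `C_n^{(1)}`. -/
def Rbar (n : ℕ) (z : K) : M2 n :=
  (∑ i ∈ Icc 1 (2*n), E n i i ⊗ₖ E n i i)
  + (r * s * (z - 1) / (z * r - s)) • S1 n
  + ((z - 1) / (z * r - s)) • S2 n
  + ((r - s) / (z * r - s)) •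
      (∑ i ∈ Icc 1 (2*n), ∑ j ∈ Icc 1 (i-1), if i ≠ 2*n + 1 - j then E n i j ⊗ₖ E n j i else 0)
  + ((r - s) * z / (z * r - s)) •
      (∑ i ∈ Icc 1 (2*n), ∑ j ∈ Icc (i+1) (2*n), if i ≠ 2*n + 1 - j then E n i j ⊗ₖ E n j i else 0)
  + (1 / ((z - r⁻¹ * s) * (z - nExp n))) •
      (∑ i ∈ Icc 1 (2*n), ∑ j ∈ Icc 1 (2*n), aC n z i j • (E n (2*n+1-i) (2*n+1-j) ⊗ₖ E n i j))

def lift12 (n : ℕ) (X : M2 n) :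
    Matrix (Fin (2*n) × (Fin (2*n) × Fin (2*n))) (Fin (2*n) × (Fin (2*n) × Fin (2*n))) K :=
  Matrix.reindex (Equiv.prodAssoc _ _ _) (Equiv.prodAssoc _ _ _)
    (X ⊗ₖ (1 : Matrix (Fin (2*n)) (Fin (2*n)) K))

def lift23 (n : ℕ) (X : M2 n) :
    Matrix (Fin (2*n) × (Fin (2*n) × Fin (2*n))) (Fin (2*n) × (Fin (2*n) × Fin (2*n))) K :=
  (1 : Matrix (Fin (2*n)) (Fin (2*n)) K) ⊗ₖ X

def lift13 (n : ℕ) (X : M2 n) :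
    Matrix (Fin (2*n) × (Fin (2*n) × Fin (2*n))) (Fin (2*n) × (Fin (2*n) × Fin (2*n))) K :=
  lift23 n (Pmat n) * lift12 n X * lift23 n (Pmat n)

namespace YB
open Finset

structure Dat (A : Type*) [CommRing A] (n : ℕ) where
  q : A
  qi : A
  l : A
  hq : q * qi = 1
  D : Fin (2*n) → Fin (2*n) → A
  Daa : ∀ a, D a a = q
  Dar : ∀ a, D a a.rev = qi
  Dsymm : ∀ a b, b ≠ a → b ≠ a.rev → D a b * D b a = 1
  Drev1 : ∀ a b, D a b * D a.rev b = 1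
  Drev2 : ∀ a b, D a b * D a b.rev = 1
  u : Fin (2*n) → A
  uu : ∀ a, u a * u a.rev = -1
  loop : ∀ a b, a < b → (q - qi) * ∑ i, (if a < i ∧ i < b then u i ^ 2 else 0)
    = qi * u a ^ 2 - q * u b ^ 2 - if a < a.rev ∧ b.rev < b then q - qi else 0
  tail : ∀ a, (q - qi) * ∑ i, (if a < i then u i ^ 2 else 0)
    = qi * u a ^ 2 + l - if a < a.rev then q - qi else 0

variable {A : Type*} [CommRing A] {n : ℕ}

def Dat.tr (d : Dat A n) : Dat A n :=
  { d with
    D := fun a b => d.D b a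
    Daa := d.Daa
    Dar := fun a => by simpa using d.Dar a.rev
    Dsymm := fun a b h1 h2 => by rw [mul_comm]; exact d.Dsymm a b h1 h2
    Drev1 := fun a b => d.Drev2 b a
    Drev2 := fun a b => d.Drev1 b a }

variable (d : Dat A n)

def Dat.B (a b c e : Fin (2*n)) : A :=
  (if c = b ∧ e = a then d.D b a else 0) + (if c = a ∧ e = b then (if b < a then d.q - d.qi else 0) else 0)
  + (if e = c.rev then (if b = a.rev ∧ a.rev < c then (d.q - d.qi) * d.u a * d.u c else 0) else 0)

def Dat.U (a b : Fin (2*n)) : A := if b = a.rev then d.u a else 0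

lemma rev_ne (a : Fin (2*n)) : a.rev ≠ a := by
  intro h; have := congrArg Fin.val h; rw [Fin.val_rev] at this; have := a.2; omega

lemma eq_rev {a b : Fin (2*n)} : a = b.rev ↔ b = a.rev := by
  constructor <;> (rintro rfl; simp)

lemma B_tr (a b c e : Fin (2*n)) : d.tr.B a b c e = d.B c e a b := by
  unfold Dat.B Dat.tr
  simp only
  congr 1
  · congr 1
    · by_cases h : c = b ∧ e = a
      · obtain ⟨rfl, rfl⟩ := h; simp
      · rw [if_neg h, if_neg (by tauto)]
    · by_cases h : c = a ∧ e = b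
      · obtain ⟨rfl, rfl⟩ := h; simp
      · rw [if_neg h, if_neg (by tauto)]
  · by_cases h : e = c.rev ∧ b = a.rev
    · obtain ⟨rfl, rfl⟩ := h
      have : a.rev < c ↔ c.rev < a := by rw [Fin.rev_lt_iff]
      simp only [this, true_and, if_true]
      split_ifs <;> ring
    · split_ifs <;> first | rfl | (exfalso; tauto)

lemma B_flip (a b c e : Fin (2*n)) : d.tr.B a b c e = d.B b.rev a.rev e.rev c.rev := by
  unfold Dat.B Dat.tr
  simp only [Fin.rev_inj, Fin.rev_rev, Fin.rev_lt_rev]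
  congr 1
  · congr 1
    · by_cases h : c = b ∧ e = a
      · obtain ⟨rfl, rfl⟩ := h
        have h1 := d.Drev1 c e
        have h2 := d.Drev2 c.rev e
        simp only [and_self, if_true]
        -- D' * D = 1 both
        have : d.D e c = d.D e.rev c.rev := by
          have h1 := d.Drev1 e c
          have h2 := d.Drev2 e.rev c
          calc d.D e c = d.D e c * (d.D e.rev c * d.D e.rev c.rev) := by rw [h2, mul_one]
            _ = (d.D e c * d.D e.rev c) * d.D e.rev c.rev := by ring
            _ = _ := by rw [h1, one_mul]
        exact this
      · rw [if_neg h, if_neg (by tauto)]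
    · by_cases h : c = a ∧ e = b
      · obtain ⟨rfl, rfl⟩ := h; simp
      · rw [if_neg h, if_neg (by tauto)]
  · by_cases h : e = c.rev ∧ b = a.rev
    · obtain ⟨rfl, rfl⟩ := h
      simp
    · have h3 : c.rev = e ↔ e = c.rev := eq_comm
      have h4 : a.rev = b ↔ b = a.rev := eq_comm
      simp only [h3, h4]
      split_ifs <;> first | rfl | (exfalso; tauto)

lemma U_flip (a b : Fin (2*n)) : d.U a b = d.U b.rev a.rev := by
  unfold Dat.U
  by_cases h : b = a.rev
  · subst h; simp
  · rw [if_neg h, if_neg]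
    simp [eq_comm]; tauto

lemma Bsum (a b : Fin (2*n)) (F : Fin (2*n) → Fin (2*n) → A) :
    ∑ x, ∑ w, d.B a b x w * F x w = d.D b a * F b a + (if b < a then (d.q-d.qi) * F a b else 0)
     + (if b = a.rev then (d.q-d.qi) * d.u a * ∑ x, (if a.rev < x then d.u x * F x x.rev else 0) else 0) := by
  unfold Dat.B
  simp only [add_mul, sum_add_distrib]
  congr 1
  · congr 1
    · simp only [ite_and, ite_mul, zero_mul]
      simp
    · simp only [ite_and, ite_mul, zero_mul]
      simp
  · simp only [ite_mul, zero_mul, Finset.sum_ite_eq', mem_univ, if_true]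
    by_cases h : b = a.rev
    · simp only [h, true_and, if_true, mul_sum]
      refine sum_congr rfl fun x _ => ?_
      split_ifs <;> ring
    · simp [h]

lemma Q_eq (a : Fin (2*n)) : d.u a ^2 * d.u a.rev ^ 2 = 1 := by
  have := d.uu a
  linear_combination (d.u a * d.u a.rev - 1) * this

lemma BU (a b : Fin (2*n)) : ∑ x, ∑ y, d.B a b x y * d.U x y = d.l * d.U a b := by
  rw [Bsum]
  have e1 : ∀ x : Fin (2*n), d.U x x.rev = d.u x := fun x => by simp [Dat.U]
  simp only [e1]
  by_cases h : b = a.rev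
  · subst h
    have hs : ∑ x, (if a.rev < x then d.u x * d.u x else 0) = ∑ x, (if a.rev < x then d.u x ^2 else 0) := by
      simp only [sq]
    have ht := d.tail a.rev
    have e3 := d.Dar a.rev
    have e4 := d.uu a
    simp only [Fin.rev_rev] at *
    rw [hs, e3, if_pos trivial, e1]
    have e2 : d.U a.rev a = d.u a.rev := by simp [Dat.U]
    rw [e2]
    split_ifs at ht ⊢ <;> linear_combination d.u a * ht + d.qi * d.u a.rev * e4
  · have : a ≠ b.rev := fun h' => h (eq_rev.1 h')
    simp [Dat.U, h, this]

lemma UB (c e : Fin (2*n)) : ∑ x, ∑ y, d.U x y * d.B x y c e = d.l * d.U c e := by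
  have := BU d.tr c e
  simp only [B_tr] at this
  simpa only [mul_comm, Dat.tr, Dat.U] using this

lemma slide (a b c f : Fin (2*n)) :
    ∑ x, ∑ w, d.B a b x w * (∑ y, d.B w c y f * d.U x y) = if f = a then d.U b c else 0 := by
  have e1 : ∀ x w : Fin (2*n), ∑ y, d.B w c y f * d.U x y = d.B w c x.rev f * d.u x := by
    intro x w; simp [Dat.U]
  simp only [e1]
  rw [Bsum]
  by_cases hb : b = a.rev
  · subst hb
    simp only [if_true]
    have e2 : ∀ x : Fin (2*n), d.B x.rev c x.rev f =
        (if c = x.rev ∧ f = c then d.q else 0) + (if f = c ∧ c < x.rev then d.q - d.qi else 0)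
        + (if c = x ∧ f = c ∧ c < c.rev then d.q - d.qi else 0) * d.u c.rev ^2 := by
      intro x
      unfold Dat.B
      simp only [Fin.rev_rev]
      congr 1
      · congr 1
        · by_cases h : c = x.rev ∧ f = c
          · obtain ⟨rfl, rfl⟩ := h; simp [d.Daa]
          · rw [if_neg h, if_neg (by rintro ⟨rfl, rfl⟩; simp at h)]
        · simp [ite_and]
      · by_cases h : c = x
        · subst h
          by_cases hf : f = c
          · subst hf; simp; intros; ring
          · simp [hf]
        · simp [h]
    by_cases hf : f = c
    · subst hf
      have e3 : ∑ x, (if a.rev < x then d.u x * (d.B x.rev f x.rev f * d.u x) else 0)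
        = (if f < a then d.q * d.u f.rev ^ 2 else 0)
          + (d.q - d.qi) * ∑ x, (if a.rev < x ∧ x < f.rev then d.u x ^ 2 else 0)
          + (if a.rev < f ∧ f < f.rev then d.q - d.qi else 0) := by
        have : ∀ x, (if a.rev < x then d.u x * (d.B x.rev f x.rev f * d.u x) else 0)
          = (if x = f.rev then (if f < a then d.q * d.u f.rev ^ 2 else 0) else 0)
           + (d.q - d.qi) * (if a.rev < x ∧ x < f.rev then d.u x ^ 2 else 0)
           + (if x = f then (if a.rev < f ∧ f < f.rev then d.q - d.qi else 0) else 0) := by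
          intro x
          rw [e2]
          have h1 : f < x.rev ↔ x < f.rev := by rw [Fin.lt_rev_iff]
          have h3 : (f = x.rev) ↔ x = f.rev := eq_rev
          simp only [h1, h3, and_true, true_and]
          by_cases hx : x = f.rev
          · subst hx
            have := rev_ne f
            have h2 : a.rev < f.rev ↔ f < a := Fin.rev_lt_rev
            simp [this, this.symm, h2]
            intros; ring
          · by_cases hx2 : x = f
            · subst hx2
              have := Q_eq d x
              simp [hx]
              split_ifs <;> first | (exfalso; tauto) | linear_combination (d.q - d.qi) * this | ring
            · have : f ≠ x := fun h => hx2 h.symm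
              simp [hx, hx2, this]
              split_ifs <;> first | (exfalso; tauto) | ring
        simp only [this, sum_add_distrib, mul_sum]
        simp
      rw [e3]
      have hl : (d.q - d.qi) * ∑ x, (if a.rev < x ∧ x < f.rev then d.u x ^ 2 else 0)
         = if f < a then d.qi * d.u a.rev ^ 2 - d.q * d.u f.rev ^ 2 - (if a.rev < a ∧ f < f.rev then d.q - d.qi else 0) else 0 := by
        by_cases h : f < a
        · have := d.loop a.rev f.rev (Fin.rev_lt_rev.2 h)
          simp only [Fin.rev_rev] at this
          rw [this, if_pos h]
        · rw [if_neg h, sum_eq_zero, mul_zero]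
          intro x _
          rw [if_neg]
          rintro ⟨h1, h2⟩
          exact h (Fin.rev_lt_rev.1 (h1.trans h2))
      rw [hl]
      have e5 : d.D a.rev a = d.qi := by simpa using d.Dar a.rev
      have e6 := d.uu a
      have e7 : d.B a f a f = (if a = f then d.q else 0) + (if f < a then d.q - d.qi else 0)
          + (if a.rev = f ∧ a.rev < a then (d.q - d.qi) * d.u a ^ 2 else 0) := by
        unfold Dat.B
        by_cases h : a = f
        · subst h; simp [d.Daa, (rev_ne a).symm, (rev_ne a)]
        · have h' : f ≠ a := fun h' => h h'.symm
          by_cases h2 : a.rev = f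
          · subst h2; simp [h, h']; intros; ring
          · have h2' : f ≠ a.rev := fun h' => h2 h'.symm
            simp [h, h', h2, h2']
      have e8 : d.B a.rev f a.rev f = (if a.rev = f then d.q else 0) + (if f < a.rev then d.q - d.qi else 0)
         + (if a = f ∧ a < a.rev then (d.q - d.qi) * d.u a.rev ^ 2 else 0) := by
        rw [e2]; 
        by_cases h : a = f
        · subst h; simp [(rev_ne a), (rev_ne a).symm]
        · have h' : f ≠ a := fun h' => h h'.symm
          simp [h, h', eq_comm]
      have e9 : (if f = a then d.U a.rev f else 0) = if f = a then d.u a.rev else 0 := by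
        split_ifs with h
        · subst h; simp [Dat.U]
        · rfl
      simp only [e9, e5, Fin.rev_rev, e7, e8]
      have v1 := a.2
      have v2 := f.2
      have r1 := Fin.val_rev a
      have r2 := Fin.val_rev f
      simp only [Fin.lt_def, Fin.ext_iff] at *
      have e6' : d.u a * d.u a.rev ^2 = - d.u a.rev := by linear_combination d.u a.rev * e6
      have hq := d.hq
      split_ifs <;> first
        | (exfalso; omega)
        | ring1
        | linear_combination (d.q - d.qi) * d.qi * e6'
        | linear_combination d.u a.rev * hq
        | linear_combination (d.q - d.qi) * d.qi * e6' + (d.q - d.qi) * d.qi * d.u a * e6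
    · have e4 := e2 a.rev
      simp only [Fin.rev_rev] at e4
      simp only [Fin.rev_rev, e4, e2, hf, and_false, false_and, if_false, add_zero, zero_mul, mul_zero, ite_self, sum_const_zero]
      by_cases h : f = a
      · subst h
        have : c ≠ f := fun h => hf h.symm
        simp [Dat.U, this]
      · simp [h]
  · have hb' : a ≠ b.rev := fun h => hb (eq_rev.1 h)
    have hb2 : b.rev ≠ a := fun h => hb' h.symm
    have hb3 : a.rev ≠ b := fun h => hb h.symm
    have e2 : d.B a c b.rev f = (if c = b.rev ∧ f = a then d.D b.rev a else 0)
        + (if c = a.rev ∧ f = b ∧ b < a then (d.q - d.qi) * d.u a * d.u b.rev else 0) := by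
      unfold Dat.B
      simp only [hb2, false_and, if_false, add_zero, Fin.rev_rev, Fin.rev_lt_rev]
      congr 1
      · by_cases h : c = b.rev
        · subst h; simp
        · have : b.rev ≠ c := fun h' => h h'.symm
          simp [h, this]
      · split_ifs <;> first | rfl | (exfalso; tauto)
    have e3 : d.B b c a.rev f = (if c = a.rev ∧ f = b then d.D a.rev b else 0)
        + (if f = a ∧ c = b.rev ∧ a < b then (d.q - d.qi) * d.u b * d.u a.rev else 0) := by
      unfold Dat.B
      simp only [hb3, false_and, if_false, add_zero, Fin.rev_rev, Fin.rev_lt_rev]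
      congr 1
      · by_cases h : c = a.rev
        · subst h; simp
        · have : a.rev ≠ c := fun h' => h h'.symm
          simp [h, this]
      · split_ifs <;> first | rfl | (exfalso; tauto)
    have h1 := d.uu b
    have h2 := d.Drev1 b a
    have h3 := d.Drev1 a b
    simp only [e2, e3, if_neg hb, add_zero, Dat.U]
    by_cases hba : b < a
    · have hne : a ≠ b := ne_of_gt hba
      have h4 := d.Dsymm b a hne hb'
      have hn : ¬ a < b := not_lt.2 hba.le
      have h5 : d.D a.rev b = d.D b a := by
        calc d.D a.rev b = (d.D b a * d.D a b) * d.D a.rev b := by rw [h4, one_mul]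
          _ = d.D b a * (d.D a b * d.D a.rev b) := by ring
          _ = _ := by rw [h3, mul_one]
      by_cases hf : f = a
      · subst hf
        simp only [hba, hne, hn, if_true, and_true, and_false, false_and, if_false, true_and]
        split_ifs <;> first | linear_combination d.u b * h2 | ring1
      · simp only [hf, hba, hn, if_true, and_true, and_false, false_and, if_false, true_and]
        split_ifs <;> first | linear_combination (d.q - d.qi) * d.u a * d.D b a * h1 + (d.q - d.qi) * d.u a * h5 | ring1
    · simp only [hba, and_false, if_false, add_zero]
      by_cases hf : f = a
      · subst hf
        simp only [and_true, if_true]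
        split_ifs <;> first | linear_combination d.u b * h2 | ring1
      · simp [hf]

end YB

namespace YB
set_option linter.all false
open Finset
variable {A : Type*} [CommRing A] {n : ℕ} (d : Dat A n)

set_option maxHeartbeats 1000000 in
lemma skein (a b c e : Fin (2*n)) : ∑ x, ∑ y, d.B a b x y * d.B x y c e =
    (if a = c ∧ b = e then 1 else 0) + (d.q - d.qi) * d.B a b c e
     + (d.q - d.qi) * d.l * (d.U a b * d.U c e) := by
  rw [Bsum]
  have hq := d.hq
  by_cases hb : b = a.rev
  · subst hb
    simp only [if_true]
    by_cases he : e = c.rev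
    · subst he
      have e0 : ∀ x : Fin (2*n), d.B x x.rev c c.rev = (if c = x.rev then d.qi else 0)
        + (if c = x ∧ x.rev < x then d.q - d.qi else 0)
        + (if x.rev < c then (d.q - d.qi) * d.u x * d.u c else 0) := by
        intro x
        unfold Dat.B
        have := d.Dar x.rev
        simp only [Fin.rev_rev] at this
        simp only [true_and, if_true, this, Fin.rev_inj]
        congr 1
        congr 1
        · by_cases h : c = x.rev
          · subst h; simp
          · simp [h]
        · by_cases h : c = x
          · subst h; simp
          · simp [h]
      have e1 : ∑ x, (if a.rev < x then d.u x * d.B x x.rev c c.rev else 0)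
         = (if a.rev < c.rev then d.qi * d.u c.rev else 0)
           + (if a.rev < c ∧ c.rev < c then (d.q - d.qi) * d.u c else 0)
           + (d.q - d.qi) * (∑ x, (if max a.rev c.rev < x then d.u x ^ 2 else 0)) * d.u c := by
        have : ∀ x, (if a.rev < x then d.u x * d.B x x.rev c c.rev else 0)
           = (if x = c.rev then (if a.rev < c.rev then d.qi * d.u c.rev else 0) else 0)
           + (if x = c then (if a.rev < c ∧ c.rev < c then (d.q - d.qi) * d.u c else 0) else 0)
           + (d.q - d.qi) * ((if max a.rev c.rev < x then d.u x ^ 2 else 0)) * d.u c := by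
          intro x
          rw [e0]
          have h1 : x.rev < c ↔ c.rev < x := Fin.rev_lt_iff
          have h3 : (c = x.rev) ↔ x = c.rev := eq_rev
          have h4 : c = x ↔ x = c := eq_comm
          simp only [h1, h3, h4, max_lt_iff]
          by_cases hx : x = c
          · subst hx
            have := rev_ne x
            simp only [this.symm, if_false, if_true, true_and]
            split_ifs <;> first | (exfalso; tauto) | ring1
          · by_cases hx2 : x = c.rev
            · subst hx2
              have := rev_ne c
              simp only [this, if_false, if_true, false_and, lt_irrefl, and_false]
              split_ifs <;> first | (exfalso; tauto) | ring1
            · simp only [hx, hx2, if_false, false_and]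
              split_ifs <;> first | (exfalso; tauto) | ring1
        simp only [this, sum_add_distrib, mul_sum, sum_mul]
        simp
      have hU : ∀ x, d.U x x.rev = d.u x := fun x => by simp [Dat.U]
      have ht := d.tail (max a.rev c.rev)
      have e2 := e0 a.rev
      rw [Fin.rev_rev] at e2
      have e3 := d.Dar a.rev
      rw [Fin.rev_rev] at e3
      rw [e1, e2, e0, hU, hU, e3]
      have u1 := d.uu a
      have u2 := d.uu c
      have v1 := a.2
      have v2 := c.2
      have r1 := Fin.val_rev a
      have r2 := Fin.val_rev c
      rw [ht]
      clear ht e1 e2 e0 hU e3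
      have Q := Q_eq d a
      have hcr : c = a.rev ↔ a = c.rev := eq_rev
      have hac : ((c = a) ↔ (a = c)) := eq_comm
      simp only [and_true, Fin.rev_inj, and_self, Fin.rev_rev, hac]
      have T1 : a.rev < c.rev ↔ c < a := Fin.rev_lt_rev
      have T2 : a.rev < c ↔ c.rev < a := Fin.rev_lt_iff
      rcases lt_trichotomy c a with h | rfl | h
      · have hm : max a.rev c.rev = c.rev := max_eq_right (Fin.rev_le_rev.2 h.le)
        have h1 : ¬ a = c := fun h' => absurd h' h.ne'
        have h2 : ¬ a < c := h.not_gt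
        rw [hm]
        by_cases h3 : c = a.rev
        · subst h3
          have h4 : ¬ a < a.rev := h.not_gt
          simp only [T1, T2, h, h1, h4, Fin.rev_rev, if_true, if_false, false_and, true_and, lt_irrefl, and_false]
          linear_combination (d.q - d.qi) * d.qi * d.u a ^ 2 * u1
        · have h3' : ¬ c.rev = a := fun h' => h3 (hcr.2 h'.symm)
          have h5 : ¬ a = c.rev := fun h' => h3' h'.symm
          simp only [T1, T2, h, h1, h2, h3, h5, Fin.rev_rev, if_true, if_false, false_and, true_and, and_true]
          simp only [Fin.lt_def, Fin.ext_iff] at *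
          split_ifs <;> first
            | (exfalso; omega)
            | linear_combination (d.q - d.qi) * d.qi * d.u a * d.u c.rev * u2
      · have h0 := (rev_ne c)
        have h1 := h0.symm
        simp only [h1, max_self, lt_irrefl, if_false, if_true, true_and, and_self, false_and, Fin.rev_rev, and_true]
        split_ifs <;> linear_combination (d.q - d.qi) * d.qi * Q + hq
      · have hm : max a.rev c.rev = a.rev := max_eq_left (Fin.rev_le_rev.2 h.le)
        have h1 : ¬ a = c := fun h' => absurd h' h.ne
        have h2 : ¬ c < a := h.not_gt
        rw [hm]
        by_cases h3 : c = a.rev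
        · subst h3
          have h4 : ¬ a.rev < a := h.not_gt
          simp only [T1, h, h1, h4, Fin.rev_rev, if_true, if_false, false_and, true_and, lt_irrefl, and_false, and_true]
          linear_combination (d.q - d.qi) * d.qi * d.u a.rev ^ 2 * u1
        · have h3' : ¬ c.rev = a := fun h' => h3 (hcr.2 h'.symm)
          have h5 : ¬ a = c.rev := fun h' => h3' h'.symm
          simp only [T1, T2, h, h1, h2, h3, h5, Fin.rev_rev, if_true, if_false, false_and, true_and, and_true]
          simp only [Fin.lt_def, Fin.ext_iff] at *
          split_ifs <;> first
            | (exfalso; omega)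
            | linear_combination (d.q - d.qi) * d.qi * d.u a.rev * d.u c * u1
    · have : ∀ x : Fin (2*n), d.B x x.rev c e = 0 := by
        intro x
        unfold Dat.B
        rw [if_neg (by rintro ⟨rfl, rfl⟩; simp at he), if_neg (by rintro ⟨rfl, rfl⟩; simp at he), if_neg he]
        simp
      have h2 := this a.rev
      rw [Fin.rev_rev] at h2
      have h3 : ¬ (a = c ∧ a.rev = e) := by rintro ⟨rfl, rfl⟩; simp at he
      simp [this, h2, Dat.U, he, h3]
  · have hb' : a ≠ b.rev := fun h => hb (eq_rev.1 h)
    simp only [if_neg hb, Dat.U, zero_mul, mul_zero, add_zero]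
    have e1 : ∀ x y : Fin (2*n), y ≠ x.rev → d.B x y c e = (if c = y ∧ e = x then d.D y x else 0) + (if c = x ∧ e = y then (if y < x then d.q - d.qi else 0) else 0) := by
      intro x y h
      unfold Dat.B
      simp [h]
    rw [e1 a b hb, e1 b a hb']
    by_cases h1 : a = c ∧ b = e
    · obtain ⟨rfl, rfl⟩ := h1
      by_cases h : a = b
      · subst h; simp [d.Daa]; linear_combination hq
      · have h' : b ≠ a := fun h' => h h'.symm
        have := d.Dsymm a b h' hb
        simp [h, h']
        split_ifs <;> linear_combination this
    · by_cases h2 : a = e ∧ b = c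
      · obtain ⟨rfl, rfl⟩ := h2
        have h : a ≠ b := fun h => h1 ⟨h, h.symm⟩
        simp [h, h.symm]
        rcases lt_or_gt_of_ne h with h3 | h3
        · simp [h3, h3.not_gt]; try ring
        · simp [h3, h3.not_gt]; try ring
      · have g1 : ¬ (c = a ∧ e = b) := fun h => h1 ⟨h.1.symm, h.2.symm⟩
        have g2 : ¬ (c = b ∧ e = a) := fun h => h2 ⟨h.2.symm, h.1.symm⟩
        simp only [g1, g2, h1, if_false]
        simp

abbrev T3 (n : ℕ) := Fin (2*n) × (Fin (2*n) × Fin (2*n))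

def L1 (X : Fin (2*n) → Fin (2*n) → Fin (2*n) → Fin (2*n) → A) : Matrix (T3 n) (T3 n) A :=
  Matrix.of fun p t => if p.2.2 = t.2.2 then X p.1 p.2.1 t.1 t.2.1 else 0

def L2 (X : Fin (2*n) → Fin (2*n) → Fin (2*n) → Fin (2*n) → A) : Matrix (T3 n) (T3 n) A :=
  Matrix.of fun p t => if p.1 = t.1 then X p.2.1 p.2.2 t.2.1 t.2.2 else 0

variable (X Y Z : Fin (2*n) → Fin (2*n) → Fin (2*n) → Fin (2*n) → A)

lemma L1_mul (N : Matrix (T3 n) (T3 n) A) (a b c : Fin (2*n)) (t : T3 n) :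
    (L1 X * N) (a, b, c) t = ∑ x, ∑ y, X a b x y * N (x, y, c) t := by
  simp only [Matrix.mul_apply, L1, Matrix.of_apply, Fintype.sum_prod_type]
  simp

lemma L2_mul (N : Matrix (T3 n) (T3 n) A) (a b c : Fin (2*n)) (t : T3 n) :
    (L2 X * N) (a, b, c) t = ∑ x, ∑ y, X b c x y * N (a, x, y) t := by
  simp only [Matrix.mul_apply, L2, Matrix.of_apply, Fintype.sum_prod_type]
  rw [Finset.sum_eq_single a]
  · simp
  · intro x _ hx; simp [hx.symm]
  · simp

lemma mul_L1 (N : Matrix (T3 n) (T3 n) A) (a b c : Fin (2*n)) (t : T3 n) :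
    (N * L1 X) t (a, b, c) = ∑ x, ∑ y, N t (x, y, c) * X x y a b := by
  simp only [Matrix.mul_apply, L1, Matrix.of_apply, Fintype.sum_prod_type]
  simp

lemma mul_L2 (N : Matrix (T3 n) (T3 n) A) (a b c : Fin (2*n)) (t : T3 n) :
    (N * L2 X) t (a, b, c) = ∑ x, ∑ y, N t (a, x, y) * X x y b c := by
  simp only [Matrix.mul_apply, L2, Matrix.of_apply, Fintype.sum_prod_type]
  rw [Finset.sum_eq_single a]
  · simp
  · intro x _ hx; simp [hx]
  · simp

lemma L1_add : L1 (X + Y) = L1 X + L1 Y := by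
  ext p t; simp only [L1, Matrix.of_apply, Matrix.add_apply, Pi.add_apply]; split_ifs <;> simp
lemma L2_add : L2 (X + Y) = L2 X + L2 Y := by
  ext p t; simp only [L2, Matrix.of_apply, Matrix.add_apply, Pi.add_apply]; split_ifs <;> simp
lemma L1_smul (k : A) : L1 (k • X) = k • L1 X := by
  ext p t; simp only [L1, Matrix.of_apply, Matrix.smul_apply, Pi.smul_apply]; split_ifs <;> simp
lemma L2_smul (k : A) : L2 (k • X) = k • L2 X := by
  ext p t; simp only [L2, Matrix.of_apply, Matrix.smul_apply, Pi.smul_apply]; split_ifs <;> simp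

def one4 : Fin (2*n) → Fin (2*n) → Fin (2*n) → Fin (2*n) → A :=
  fun a b c e => if a = c ∧ b = e then 1 else 0

lemma L1_one : L1 (one4 : Fin (2*n) → Fin (2*n) → Fin (2*n) → Fin (2*n) → A) = 1 := by
  ext ⟨a, b, c⟩ ⟨x, y, z⟩
  simp only [L1, one4, Matrix.of_apply, Matrix.one_apply, Prod.mk.injEq]
  split_ifs <;> first | rfl | (exfalso; tauto)
lemma L2_one : L2 (one4 : Fin (2*n) → Fin (2*n) → Fin (2*n) → Fin (2*n) → A) = 1 := by
  ext ⟨a, b, c⟩ ⟨x, y, z⟩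
  simp only [L2, one4, Matrix.of_apply, Matrix.one_apply, Prod.mk.injEq]
  split_ifs <;> first | rfl | (exfalso; tauto)

def comp4 : Fin (2*n) → Fin (2*n) → Fin (2*n) → Fin (2*n) → A :=
  fun a b c e => ∑ x, ∑ y, X a b x y * Y x y c e

lemma L1_comp : L1 X * L1 Y = L1 (comp4 X Y) := by
  ext ⟨a, b, c⟩ ⟨x, y, z⟩
  rw [L1_mul]
  simp only [L1, comp4, Matrix.of_apply]
  split_ifs <;> simp
lemma L2_comp : L2 X * L2 Y = L2 (comp4 X Y) := by
  ext ⟨a, b, c⟩ ⟨x, y, z⟩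
  rw [L2_mul]
  simp only [L2, comp4, Matrix.of_apply]
  split_ifs <;> simp

def Dat.E (a b c e : Fin (2*n)) : A := - (d.U a b * d.U c e)

abbrev Dat.B1 : Matrix (T3 n) (T3 n) A := L1 d.B
abbrev Dat.B2 : Matrix (T3 n) (T3 n) A := L2 d.B
abbrev Dat.E1 : Matrix (T3 n) (T3 n) A := L1 d.E
abbrev Dat.E2 : Matrix (T3 n) (T3 n) A := L2 d.E

lemma skein4 : comp4 d.B d.B = one4 + (d.q - d.qi) • d.B + (-((d.q - d.qi) * d.l)) • d.E := by
  funext a b c e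
  simp only [comp4, skein, one4, Dat.E, Pi.add_apply, Pi.smul_apply, smul_eq_mul]
  ring

lemma BE4 : comp4 d.B d.E = d.l • d.E := by
  funext a b c e
  simp only [comp4, Dat.E, Pi.smul_apply, smul_eq_mul, mul_neg, sum_neg_distrib, ← mul_assoc, ← sum_mul, BU]

lemma EB4 : comp4 d.E d.B = d.l • d.E := by
  funext a b c e
  simp only [comp4, Dat.E, Pi.smul_apply, smul_eq_mul, mul_neg, neg_mul, sum_neg_distrib, mul_assoc, ← mul_sum, UB]
  ring

lemma skein1 : d.B1 * d.B1 = 1 + (d.q - d.qi) • d.B1 + (-((d.q - d.qi) * d.l)) • d.E1 := by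
  rw [Dat.B1, Dat.E1, L1_comp, skein4, L1_add, L1_add, L1_smul, L1_smul, L1_one]
lemma skein2 : d.B2 * d.B2 = 1 + (d.q - d.qi) • d.B2 + (-((d.q - d.qi) * d.l)) • d.E2 := by
  rw [Dat.B2, Dat.E2, L2_comp, skein4, L2_add, L2_add, L2_smul, L2_smul, L2_one]
lemma B1E1 : d.B1 * d.E1 = d.l • d.E1 := by
  rw [Dat.B1, Dat.E1, L1_comp, BE4, L1_smul]
lemma B2E2 : d.B2 * d.E2 = d.l • d.E2 := by
  rw [Dat.B2, Dat.E2, L2_comp, BE4, L2_smul]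
lemma E1B1 : d.E1 * d.B1 = d.l • d.E1 := by
  rw [Dat.B1, Dat.E1, L1_comp, EB4, L1_smul]
lemma E2B2 : d.E2 * d.B2 = d.l • d.E2 := by
  rw [Dat.B2, Dat.E2, L2_comp, EB4, L2_smul]

lemma UUs (a f : Fin (2*n)) : ∑ x, d.U x f * d.U a x = if f = a then -1 else 0 := by
  have : ∀ x, d.U x f * d.U a x = if x = a.rev then d.U a.rev f * d.u a else 0 := by
    intro x; simp only [Dat.U]; by_cases h : x = a.rev
    · subst h; simp
    · simp [h]
  simp only [this, sum_ite_eq', mem_univ, if_true]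
  simp only [Dat.U, Fin.rev_rev]
  have := d.uu a
  split_ifs
  · linear_combination this
  · simp

lemma L1L2 (a b c x y z : Fin (2*n)) : (L1 X * L2 Y) (a, b, c) (x, y, z) = ∑ w, X a b x w * Y w c y z := by
  rw [L1_mul]
  simp only [L2, Matrix.of_apply]
  rw [Finset.sum_eq_single x]
  · simp
  · intro w _ h; simp [h]
  · simp
lemma L2L1 (a b c x y z : Fin (2*n)) : (L2 X * L1 Y) (a, b, c) (x, y, z) = ∑ w, X b c w z * Y a w x y := by
  rw [L2_mul]
  simp only [L1, Matrix.of_apply]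
  simp

lemma E2E1_apply (a b c x y z : Fin (2*n)) : (d.E2 * d.E1) (a, b, c) (x, y, z) = if z = a then - (d.U b c * d.U x y) else 0 := by
  rw [L2L1]
  have : ∀ w, d.E b c w z * d.E a w x y = (d.U w z * d.U a w) * (d.U b c * d.U x y) := by
    intro w; unfold Dat.E; ring
  simp only [this, ← sum_mul, UUs]
  split_ifs <;> ring

lemma BBE : d.B1 * d.B2 * d.E1 = d.E2 * d.E1 := by
  ext ⟨a, b, c⟩ ⟨x, y, z⟩
  rw [E2E1_apply, mul_assoc, L1_mul]
  simp only [L2L1]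
  have := slide d a b c z
  have h : ∀ x_1 y_1, ∑ w, d.B y_1 c w z * d.E x_1 w x y = (∑ w, d.B y_1 c w z * d.U x_1 w) * (- d.U x y) := by
    intro x1 y1; rw [sum_mul]; refine sum_congr rfl fun w _ => ?_; unfold Dat.E; ring
  simp only [h, ← mul_assoc, ← sum_mul]
  simp only [this]
  split_ifs <;> ring

def flip3 : T3 n ≃ T3 n where
  toFun p := (p.2.2.rev, p.2.1.rev, p.1.rev)
  invFun p := (p.2.2.rev, p.2.1.rev, p.1.rev)
  left_inv p := by simp
  right_inv p := by simp

lemma flip_L1 : (L1 X).submatrix flip3 flip3 = L2 (fun a b c e => X b.rev a.rev e.rev c.rev) := by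
  ext ⟨a, b, c⟩ ⟨x, y, z⟩
  simp [L1, L2, flip3]
lemma flip_L2 : (L2 X).submatrix flip3 flip3 = L1 (fun a b c e => X b.rev a.rev e.rev c.rev) := by
  ext ⟨a, b, c⟩ ⟨x, y, z⟩
  simp [L1, L2, flip3]
lemma B4_flip : (fun a b c e : Fin (2*n) => d.tr.B b.rev a.rev e.rev c.rev) = d.B := by
  funext a b c e; rw [B_flip]; simp
lemma E4_flip : (fun a b c e : Fin (2*n) => d.tr.E b.rev a.rev e.rev c.rev) = d.E := by
  funext a b c e; unfold Dat.E; rw [← U_flip, ← U_flip]; rfl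

lemma tr_L1 : (L1 X).transpose = L1 (fun a b c e => X c e a b) := by
  ext ⟨a, b, c⟩ ⟨x, y, z⟩
  simp [L1, eq_comm]
lemma tr_L2 : (L2 X).transpose = L2 (fun a b c e => X c e a b) := by
  ext ⟨a, b, c⟩ ⟨x, y, z⟩
  simp [L2, eq_comm]
lemma B4_tr : (fun a b c e : Fin (2*n) => d.tr.B c e a b) = d.B := by
  funext a b c e; rw [B_tr]
lemma E4_tr : (fun a b c e : Fin (2*n) => d.tr.E c e a b) = d.E := by
  funext a b c e; unfold Dat.E; rw [mul_comm]; rfl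

lemma BBE' : d.B2 * d.B1 * d.E2 = d.E1 * d.E2 := by
  have := congrArg (fun N : Matrix (T3 n) (T3 n) A => N.submatrix flip3 flip3) (BBE d.tr)
  simp only [← Matrix.submatrix_mul_equiv _ _ _ flip3, flip_L1, flip_L2, B4_flip, E4_flip] at this
  exact this
lemma EBB : d.E1 * d.B2 * d.B1 = d.E1 * d.E2 := by
  have := congrArg Matrix.transpose (BBE d.tr)
  simp only [Matrix.transpose_mul, tr_L1, tr_L2, B4_tr, E4_tr, ← mul_assoc] at this
  exact this
lemma EBB' : d.E2 * d.B1 * d.B2 = d.E2 * d.E1 := by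
  have := congrArg Matrix.transpose (BBE' d.tr)
  simp only [Matrix.transpose_mul, tr_L1, tr_L2, B4_tr, E4_tr, ← mul_assoc] at this
  exact this

lemma EEE' : d.E2 * d.E1 * d.E2 = d.E2 := by
  ext ⟨a, b, c⟩ ⟨x, y, z⟩
  rw [mul_L2]
  simp only [E2E1_apply]
  have : ∀ w v, (if v = a then -(d.U b c * d.U x w) else 0) * d.E w v y z = if v = a then (d.U b c * d.U y z) * (d.U w a * d.U x w) else 0 := by
    intro w v; split_ifs with h
    · subst h; unfold Dat.E; ring
    · simp
  simp only [this]
  simp only [sum_ite_eq', mem_univ, if_true, ← mul_sum, UUs, Dat.E2, L2, Matrix.of_apply, Dat.E]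
  split_ifs <;> ring
lemma EEE : d.E1 * d.E2 * d.E1 = d.E1 := by
  have := congrArg (fun N : Matrix (T3 n) (T3 n) A => N.submatrix flip3 flip3) (EEE' d.tr)
  simp only [← Matrix.submatrix_mul_equiv _ _ _ flip3, flip_L1, flip_L2, E4_flip] at this
  exact this
end YB

namespace YB
set_option linter.all false
open Finset
variable {A : Type*} [CommRing A] {n : ℕ} (d : Dat A n)

def Dat.Tm : Matrix (T3 n) (T3 n) A := d.B1 * d.B2 * d.B1 - d.B2 * d.B1 * d.B2

lemma Tm_rel1 : d.B1 * d.Tm + d.Tm * d.B2 = (d.q - d.qi) • d.Tm := by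
  have h1 : d.B1 * d.Tm + d.Tm * d.B2 = (d.B1 * d.B1) * (d.B2 * d.B1) - (d.B2 * d.B1) * (d.B2 * d.B2) := by
    unfold Dat.Tm; noncomm_ring
  have h2 := EBB d
  have h3 := BBE' d
  rw [h1, skein1, skein2]
  simp only [add_mul, mul_add, smul_mul_assoc, mul_smul_comm, one_mul, mul_one, ← mul_assoc, h2, h3, Dat.Tm, smul_sub]
  abel

lemma Tm_rel2 : d.B2 * d.Tm + d.Tm * d.B1 = (d.q - d.qi) • d.Tm := by
  have h1 : d.B2 * d.Tm + d.Tm * d.B1 = (d.B1 * d.B2) * (d.B1 * d.B1) - (d.B2 * d.B2) * (d.B1 * d.B2) := by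
    unfold Dat.Tm; noncomm_ring
  have h2 := EBB' d
  have h3 := BBE d
  rw [h1, skein1, skein2]
  simp only [add_mul, mul_add, smul_mul_assoc, mul_smul_comm, one_mul, mul_one, ← mul_assoc, h2, h3, Dat.Tm, smul_sub]
  abel

lemma B_tri {a b c e : Fin (2*n)} (h : d.B a b c e ≠ 0) : b ≤ c ∧ e ≤ a := by
  unfold Dat.B at h
  by_contra hc
  apply h
  clear h
  have h1 : ¬ (c = b ∧ e = a) := by rintro ⟨rfl, rfl⟩; simp at hc
  have h2 : ¬ (c = a ∧ e = b ∧ b < a) := by rintro ⟨rfl, rfl, h⟩; exact hc ⟨h.le, h.le⟩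
  have h3 : ¬ (e = c.rev ∧ b = a.rev ∧ a.rev < c) := by
    rintro ⟨rfl, rfl, h⟩; exact hc ⟨h.le, (Fin.rev_lt_iff.1 h).le⟩
  rw [if_neg h1, ← ite_and, ← ite_and, if_neg (fun h => h2 ⟨h.1.1, h.1.2, h.2⟩), if_neg h3]
  simp

lemma B_diag1 (a b x : Fin (2*n)) : d.B a b x a = if x = b then d.D b a else 0 := by
  unfold Dat.B
  by_cases h : x = b
  · subst h
    rw [if_pos ⟨rfl, rfl⟩, if_pos rfl]
    have h1 : ¬ (x = a ∧ a = x ∧ x < a) := by rintro ⟨rfl, _, h⟩; exact lt_irrefl _ h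
    have h2 : ¬ (a = x.rev ∧ x = a.rev ∧ a.rev < x) := by rintro ⟨_, h1, h⟩; rw [← h1] at h; exact lt_irrefl _ h
    split_ifs <;> first | (exfalso; tauto) | simp
  · have h1 : ¬ (x = a ∧ a = b) := by rintro ⟨rfl, rfl⟩; exact h rfl
    have h2 : ¬ (a = x.rev ∧ b = a.rev) := by rintro ⟨h1, h2⟩; rw [h2, h1] at h; simp at h
    simp only [h, h1, if_false, false_and]
    split_ifs <;> first | (exfalso; tauto) | simp

lemma B_diag2 (a b y : Fin (2*n)) : d.B a b b y = if y = a then d.D b a else 0 := by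
  have := B_diag1 d.tr b.rev a.rev y.rev
  rw [B_flip] at this
  simp only [Fin.rev_rev, Fin.rev_inj] at this
  rw [this]
  have h1 : d.tr.D a.rev b.rev = d.D b a := by
    show d.D b.rev a.rev = d.D b a
    have h1 := d.Drev1 b a
    have h2 := d.Drev2 b.rev a
    calc d.D b.rev a.rev = (d.D b a * d.D b.rev a) * d.D b.rev a.rev := by rw [h1, one_mul]
      _ = d.D b a * (d.D b.rev a * d.D b.rev a.rev) := by ring
      _ = _ := by rw [h2, mul_one]
  rw [h1]

lemma BBB1 (a b c x y z : Fin (2*n)) : (d.B1 * d.B2 * d.B1) (a,b,c) (x,y,z)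
   = ∑ v, ∑ w, d.B a b v w * ∑ u, d.B w c u z * d.B v u x y := by
  rw [mul_assoc, L1_mul]; simp only [L2L1]
lemma BBB2 (a b c x y z : Fin (2*n)) : (d.B2 * d.B1 * d.B2) (a,b,c) (x,y,z)
   = ∑ w, ∑ u, d.B b c w u * ∑ v, d.B a w x v * d.B v u y z := by
  rw [mul_assoc, L2_mul]; simp only [L1L2]

lemma Tm_tri {a b c x y z : Fin (2*n)} (h : d.Tm (a,b,c) (x,y,z) ≠ 0) : c ≤ x ∧ z ≤ a := by
  by_contra hc
  apply h
  rw [Dat.Tm, Matrix.sub_apply, BBB1, BBB2]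
  have h1 : ∀ v w u, d.B a b v w * (d.B w c u z * d.B v u x y) = 0 := by
    intro v w u
    by_contra h0
    have t1 := B_tri d (left_ne_zero_of_mul h0)
    have t2 := B_tri d (left_ne_zero_of_mul (right_ne_zero_of_mul h0))
    have t3 := B_tri d (right_ne_zero_of_mul (right_ne_zero_of_mul h0))
    exact hc ⟨t2.1.trans t3.1, t2.2.trans t1.2⟩
  have h2 : ∀ v w u, d.B b c w u * (d.B a w x v * d.B v u y z) = 0 := by
    intro v w u
    by_contra h0
    have t1 := B_tri d (left_ne_zero_of_mul h0)
    have t2 := B_tri d (left_ne_zero_of_mul (right_ne_zero_of_mul h0))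
    have t3 := B_tri d (right_ne_zero_of_mul (right_ne_zero_of_mul h0))
    exact hc ⟨t1.1.trans t2.1, t3.2.trans t2.2⟩
  simp only [mul_sum, h1, h2, sum_const_zero, sub_zero]

lemma Tm_anti (a b c : Fin (2*n)) : d.Tm (a,b,c) (c,b,a) = 0 := by
  rw [Dat.Tm, Matrix.sub_apply, BBB1, BBB2]
  have h1 : ∀ v w u, d.B a b v w * (d.B w c u a * d.B v u c b) = if v = b then (if w = a then (if u = c then d.D b a * d.D c a * d.D c b else 0) else 0) else 0 := by
    intro v w u
    by_cases hw : w = a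
    · subst hw
      rw [B_diag1, B_diag1]
      by_cases hv : v = b
      · by_cases hu : u = c
        · subst hv hu
          simp [B_diag1]; ring
        · simp [hu]
      · simp [hv]
    · have : d.B a b v w * (d.B w c u a * d.B v u c b) = 0 := by
        by_contra h0
        have t1 := B_tri d (left_ne_zero_of_mul h0)
        have t2 := B_tri d (left_ne_zero_of_mul (right_ne_zero_of_mul h0))
        exact hw (le_antisymm t1.2 t2.2)
      rw [this]; simp [hw]
  have h2 : ∀ v w u, d.B b c w u * (d.B a w c v * d.B v u b a) = if w = c then (if u = b then (if v = a then d.D b a * d.D c a * d.D c b else 0) else 0) else 0 := by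
    intro v w u
    by_cases hw : w = c
    · subst hw
      rw [B_diag2, B_diag2]
      by_cases hv : v = a
      · by_cases hu : u = b
        · subst hv hu
          simp [B_diag1]; ring
        · simp [hu]
      · simp [hv]
    · have : d.B b c w u * (d.B a w c v * d.B v u b a) = 0 := by
        by_contra h0
        have t1 := B_tri d (left_ne_zero_of_mul h0)
        have t2 := B_tri d (left_ne_zero_of_mul (right_ne_zero_of_mul h0))
        exact hw (le_antisymm t2.1 t1.1)
      rw [this]; simp [hw]
  simp only [mul_sum, h1, h2]
  simp

lemma D_dvd {p : A} {a b : Fin (2*n)} {x : A} (h : p ∣ d.D a b * x) : p ∣ x := by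
  have h1 := d.Drev1 a b
  have : x = d.D a.rev b * (d.D a b * x) := by linear_combination -x * h1
  rw [this]; exact h.mul_left _

lemma m_dvd : d.q - 1 ∣ d.q - d.qi := ⟨1 + d.qi, by linear_combination - d.hq⟩

lemma BsumL_dvd (a b : Fin (2*n)) (F : Fin (2*n) → Fin (2*n) → A) :
    d.q - 1 ∣ ∑ x, ∑ w, d.B a b x w * F x w - d.D b a * F b a := by
  rw [Bsum]
  have := m_dvd d
  rw [add_assoc, add_sub_cancel_left]
  apply dvd_add
  · split_ifs
    · exact this.mul_right _
    · simp
  · split_ifs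
    · rw [mul_assoc]; exact this.mul_right _
    · simp

lemma BsumR_dvd (c e : Fin (2*n)) (F : Fin (2*n) → Fin (2*n) → A) :
    d.q - 1 ∣ ∑ x, ∑ w, F x w * d.B x w c e - d.D c e * F e c := by
  have := BsumL_dvd d.tr c e F
  simp only [B_tr] at this
  simpa only [mul_comm, Dat.tr] using this

lemma step (U : Matrix (T3 n) (T3 n) A)
   (h1 : d.B1 * U + U * d.B2 = (d.q - d.qi) • U)
   (h2 : d.B2 * U + U * d.B1 = (d.q - d.qi) • U)
   (htri : ∀ a b c x y z, U (a,b,c) (x,y,z) ≠ 0 → c ≤ x ∧ z ≤ a)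
   (hanti : ∀ a b c, U (a,b,c) (c,b,a) = 0) (p t : T3 n) : d.q - 1 ∣ U p t := by
  have htri' : ∀ a b c x y z, ¬ (d.q - 1 ∣ U (a,b,c) (x,y,z)) → c ≤ x ∧ z ≤ a := by
    intro a b c x y z h
    apply htri a b c x y z
    intro h0; rw [h0] at h; exact h (dvd_zero _)
  have hm := m_dvd d
  have I : ∀ a b c x y z, d.q - 1 ∣ U (b,a,c) (x,y,z) → d.q - 1 ∣ U (a,b,c) (x,z,y) := by
    intro a b c x y z h
    have e := congrFun (congrFun h1 (a,b,c)) (x,y,z)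
    rw [Matrix.add_apply, L1_mul, mul_L2, Matrix.smul_apply, smul_eq_mul] at e
    have k1 := BsumL_dvd d a b (fun v w => U (v,w,c) (x,y,z))
    have k2 := BsumR_dvd d y z (fun v w => U (a,b,c) (x,v,w))
    apply D_dvd d (a := y) (b := z)
    have k3 : d.q - 1 ∣ (d.q - d.qi) * U (a,b,c) (x,y,z) := hm.mul_right _
    rw [← e] at k3
    have k4 := dvd_sub (dvd_sub (dvd_sub k3 k1) k2) (h.mul_left (d.D b a))
    convert k4 using 1
    ring
  have II : ∀ a b c x y z, d.q - 1 ∣ U (a,c,b) (x,y,z) → d.q - 1 ∣ U (a,b,c) (y,x,z) := by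
    intro a b c x y z h
    have e := congrFun (congrFun h2 (a,b,c)) (x,y,z)
    rw [Matrix.add_apply, L2_mul, mul_L1, Matrix.smul_apply, smul_eq_mul] at e
    have k1 := BsumL_dvd d b c (fun v w => U (a,v,w) (x,y,z))
    have k2 := BsumR_dvd d x y (fun v w => U (a,b,c) (v,w,z))
    apply D_dvd d (a := x) (b := y)
    have k3 : d.q - 1 ∣ (d.q - d.qi) * U (a,b,c) (x,y,z) := hm.mul_right _
    rw [← e] at k3
    have k4 := dvd_sub (dvd_sub (dvd_sub k3 k1) k2) (h.mul_left (d.D c b))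
    convert k4 using 1
    ring
  have mid : ∀ a b c x y z, ¬ (d.q - 1 ∣ U (a,b,c) (x,y,z)) → b = y := by
    intro a b c x y z h
    have g1 := (htri' b a c x z y (fun h' => h (I _ _ _ _ _ _ h'))).2
    have g2 := (htri' a c b y x z (fun h' => h (II _ _ _ _ _ _ h'))).1
    exact le_antisymm g2 g1
  obtain ⟨a, b, c⟩ := p
  obtain ⟨x, y, z⟩ := t
  by_contra h
  have g1 := mid _ _ _ _ _ _ h
  have g2 := mid b a c x z y (fun h' => h (I _ _ _ _ _ _ h'))
  have g3 := mid a c b y x z (fun h' => h (II _ _ _ _ _ _ h'))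
  subst g1 g2 g3
  rw [hanti] at h
  exact h (dvd_zero _)

lemma braid_sep [IsDomain A] (hq1 : d.q - 1 ≠ 0) (hsep : ∀ x : A, (∀ k : ℕ, (d.q - 1)^k ∣ x) → x = 0) :
    d.B1 * d.B2 * d.B1 = d.B2 * d.B1 * d.B2 := by
  rw [← sub_eq_zero]
  change d.Tm = 0
  ext p t
  apply hsep
  intro k
  induction k generalizing p t with
  | zero => simp
  | succ k ih =>
    choose U hU using ih
    have hk : (d.q - 1)^k ≠ 0 := pow_ne_zero _ hq1
    have hT : d.Tm = (d.q - 1)^k • (Matrix.of U) := by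
      ext p t; simp [hU]
    have inj : ∀ X Y : Matrix (T3 n) (T3 n) A, (d.q - 1)^k • X = (d.q - 1)^k • Y → X = Y := by
      intro X Y h
      ext p t
      have := congrFun (congrFun h p) t
      simp only [Matrix.smul_apply, smul_eq_mul] at this
      exact mul_left_cancel₀ hk this
    have r1 := Tm_rel1 d
    have r2 := Tm_rel2 d
    rw [hT, mul_smul_comm, smul_mul_assoc, ← smul_add, smul_comm] at r1 r2
    have := step d (Matrix.of U) (inj _ _ r1) (inj _ _ r2) ?_ ?_ p t
    · rw [hU, pow_succ]; exact mul_dvd_mul_left _ this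
    · intro a b c x y z h
      apply Tm_tri d (a := a) (b := b) (c := c) (x := x) (y := y) (z := z)
      rw [hU]; exact mul_ne_zero hk h
    · intro a b c
      have := Tm_anti d a b c
      rw [hU] at this
      exact (mul_eq_zero.1 this).resolve_left hk
end YB

namespace YB
set_option linter.all false
open Finset
variable {A : Type*} [CommRing A] {n : ℕ}

def uN (n : ℕ) (q : Aˣ) (a : ℕ) : A :=
  if a < n then ((q ^ ((n:ℤ) - a) : Aˣ) : A) else - ((q ^ ((n:ℤ) - 1 - a) : Aˣ) : A)

def cond (n x y : ℕ) : Prop := (x < n ∧ ((x < y ∧ y < n) ∨ 2*n-1-x < y)) ∨ (n ≤ x ∧ ((n ≤ y ∧ y < x) ∨ y < 2*n-1-x))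

instance (n x y : ℕ) : Decidable (cond n x y) := by unfold cond; infer_instance

def DN (n : ℕ) (q t : Aˣ) (x y : Fin (2*n)) : A :=
  if y = x then (q:A) else if y = x.rev then ((q⁻¹ : Aˣ) : A) else
    if cond n x y then (t : A) else ((t⁻¹ : Aˣ) : A)

lemma uN_succ (q : Aˣ) (a : ℕ) (h : a + 1 ≠ n) : uN n q a = q * uN n q (a+1) := by
  unfold uN
  have h1 : a < n ↔ a + 1 < n := by omega
  simp only [h1]
  split_ifs
  · rw [← Units.val_mul, ← zpow_one_add]; congr 2; push_cast; ring
  · rw [mul_neg, ← Units.val_mul, ← zpow_one_add]; congr 3; push_cast; ring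

lemma tailN (q : Aˣ) (j : ℕ) : ∀ a : ℕ, a + j + 1 = 2 * n →
    ((q:A) - (q⁻¹ : Aˣ)) * ∑ i : Fin (2*n), (if a < i.val then uN n q i.val ^ 2 else 0)
    = ((q⁻¹ : Aˣ) : A) * uN n q a ^ 2 + (- ((q ^ (-2 * (n:ℤ) - 1) : Aˣ) : A)) - if a < n then (q:A) - (q⁻¹ : Aˣ) else 0 := by
  have hq : (q:A) * ((q⁻¹ : Aˣ) : A) = 1 := by simp
  induction j with
  | zero =>
    intro a ha
    rw [sum_eq_zero, if_neg (by omega)]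
    · unfold uN
      rw [if_neg (by omega), neg_sq, ← Units.val_pow_eq_pow_val, ← Units.val_mul, ← zpow_natCast, ← zpow_mul, ← zpow_neg_one, ← zpow_add]
      have : (-1 + ((n:ℤ) - 1 - a) * ((2:ℕ):ℤ)) = -2 * n - 1 := by
        have : (a:ℤ) = 2 * n - 1 := by omega
        rw [this]; push_cast; ring
      rw [this]; ring
    · intro i _; rw [if_neg]; have := i.2; omega
  | succ j ih =>
    intro a ha
    have := ih (a+1) (by omega)
    have e : ∑ i : Fin (2*n), (if a < i.val then uN n q i.val ^ 2 else 0)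
       = ∑ i : Fin (2*n), (if a + 1 < i.val then uN n q i.val ^ 2 else 0) + uN n q (a+1) ^ 2 := by
      have e1 : ∀ i : Fin (2*n), (if a < i.val then uN n q i.val ^ 2 else 0)
        = (if a + 1 < i.val then uN n q i.val ^ 2 else 0) + (if i = ⟨a+1, by omega⟩ then uN n q (a+1) ^ 2 else 0) := by
        intro i
        by_cases h : i = ⟨a+1, by omega⟩
        · subst h; simp
        · have h' : i.val ≠ a + 1 := fun h' => h (Fin.ext h')
          rw [if_neg h, add_zero]
          have : a < i.val ↔ a + 1 < i.val := by omega
          simp only [this]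
      simp only [e1, sum_add_distrib]
      simp
    rw [e, mul_add, this]
    by_cases h : a + 1 = n
    · have h1 : uN n q a = q := by
        unfold uN; rw [if_pos (by omega)]
        have : (n:ℤ) - a = 1 := by omega
        rw [this, zpow_one]
      have h2 : uN n q (a+1) = - ((q⁻¹ : Aˣ) : A) := by
        unfold uN; rw [if_neg (by omega)]
        have : (n:ℤ) - 1 - ((a+1:ℕ):ℤ) = -1 := by omega
        rw [this, zpow_neg_one]
      rw [h1, h2, if_neg (by omega), if_pos (by omega)]
      linear_combination (((q⁻¹ : Aˣ) : A) - q) * hq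
    · have h1 : a < n ↔ a + 1 < n := by omega
      rw [uN_succ q a h]
      simp only [h1]
      linear_combination -(q:A) * uN n q (a+1)^2 * hq

set_option maxHeartbeats 1000000 in
def mkDat (n : ℕ) (q t : Aˣ) : Dat A n where
  q := q
  qi := (q⁻¹ : Aˣ)
  l := - ((q ^ (-2 * (n:ℤ) - 1) : Aˣ) : A)
  hq := by simp
  D := DN n q t
  Daa a := by simp [DN]
  Dar a := by simp [DN, rev_ne]
  Dsymm a b h1 h2 := by
    have h3 : a ≠ b.rev := fun h => h2 (eq_rev.1 h)
    have : cond n a b ↔ ¬ cond n b a := by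
      unfold cond
      simp only [ne_eq, Fin.ext_iff, Fin.val_rev] at *
      omega
    unfold DN
    rw [if_neg h1, if_neg h2, if_neg h1.symm, if_neg h3]
    by_cases h : cond n b a <;> simp [this, h]
  Drev1 a b := by
    unfold DN
    rw [Fin.rev_rev]
    by_cases h1 : b = a
    · subst h1; simp [(rev_ne b).symm]
    · by_cases h2 : b = a.rev
      · subst h2; simp [rev_ne]
      · have : cond n a b ↔ ¬ cond n a.rev b := by
          unfold cond
          simp only [ne_eq, Fin.ext_iff, Fin.val_rev] at *
          omega
        simp only [h1, h2, if_false]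
        by_cases h : cond n a.rev b <;> simp only [this, h] <;> simp
  Drev2 a b := by
    unfold DN
    have e1 : b.rev = a ↔ b = a.rev := by rw [eq_comm, eq_rev]
    simp only [Fin.rev_inj]
    simp only [e1]
    by_cases h1 : b = a
    · subst h1; simp [(rev_ne b).symm]
    · by_cases h2 : b = a.rev
      · subst h2; simp [rev_ne]
      · have : cond n a b ↔ ¬ cond n a b.rev := by
          unfold cond
          simp only [ne_eq, Fin.ext_iff, Fin.val_rev] at *
          omega
        simp only [h1, h2, if_false]
        by_cases h : cond n a b.rev <;> simp only [this, h] <;> simp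
  u a := uN n q a
  uu a := by
    unfold uN
    rw [Fin.val_rev]
    have := a.2
    by_cases h : a.val < n
    · rw [if_pos h, if_neg (by omega), mul_neg, ← Units.val_mul, ← zpow_add]
      have : (n:ℤ) - a + (n - 1 - ((2 * n - (a.val + 1) : ℕ) : ℤ)) = 0 := by omega
      rw [this]; simp
    · rw [if_neg h, if_pos (by omega), neg_mul, ← Units.val_mul, ← zpow_add]
      have : (n:ℤ) - 1 - a + (n - ((2 * n - (a.val + 1) : ℕ) : ℤ)) = 0 := by omega
      rw [this]; simp
  tail a := by
    have := tailN (n := n) q (2 * n - 1 - a) a (by have := a.2; omega)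
    have e : a < a.rev ↔ a.val < n := by
      rw [Fin.lt_def, Fin.val_rev]; omega
    simp only [e]
    exact this
  loop a b hab := by
    have ha := tailN (n := n) q (2 * n - 1 - a) a (by have := a.2; omega)
    have hb := tailN (n := n) q (2 * n - 1 - b) b (by have := b.2; omega)
    have e : ∀ i : Fin (2*n), (if a < i ∧ i < b then uN n q i ^ 2 else 0) = 
       (if a.val < i.val then uN n q i.val ^ 2 else 0) - (if b.val < i.val then uN n q i.val ^ 2 else 0)
       - (if i = b then uN n q b.val ^ 2 else 0) := by
      intro i
      by_cases h : i = b
      · subst h; simp [Fin.lt_def.1 hab]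
      · have h' : i.val ≠ b.val := fun h' => h (Fin.ext h')
        rw [if_neg h]
        simp only [Fin.lt_def] at *
        split_ifs <;> first | (exfalso; omega) | ring1
    simp only [e, sum_sub_distrib, mul_sub]
    rw [ha, hb, sum_ite_eq', if_pos (mem_univ _)]
    have r1 := Fin.val_rev a
    have r2 := Fin.val_rev b
    simp only [Fin.lt_def] at *
    split_ifs <;> first | (exfalso; omega) | ring1

lemma mkDat_map {C : Type*} [CommRing C] (f : A →+* C) (q t : Aˣ) (a b c e : Fin (2*n)) :
    f ((mkDat n q t).B a b c e) = (mkDat n (Units.map (f : A →* C) q) (Units.map (f : A →* C) t)).B a b c e := by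
  have h1 : ∀ x : Aˣ, (((Units.map (f : A →* C) x) : Cˣ) : C) = f x := fun x => rfl
  have h2 : ∀ i : ℕ, uN n (Units.map (f : A →* C) q) i = f (uN n q i) := by
    intro i; unfold uN; rw [apply_ite f, map_neg, ← map_zpow, ← map_zpow]; rfl
  have h3 : ∀ i j, DN n (Units.map (f : A →* C) q) (Units.map (f : A →* C) t) i j = f (DN n q t i j) := by
    intro i j; unfold DN; rw [apply_ite f, apply_ite f, apply_ite f, ← map_inv, ← map_inv]; rfl
  have h4 : f ((q⁻¹ : Aˣ) : A) = (((Units.map (f : A →* C) q)⁻¹ : Cˣ) : C) := by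
    rw [← map_inv]; rfl
  simp only [Dat.B, mkDat, map_add, apply_ite f, map_zero, map_sub, map_mul, h2, h3, h4, h1]

lemma braid_map {C : Type*} [CommRing C] (f : A →+* C) (q t : Aˣ)
    (h : (mkDat n q t).B1 * (mkDat n q t).B2 * (mkDat n q t).B1 = (mkDat n q t).B2 * (mkDat n q t).B1 * (mkDat n q t).B2)
    (d : Dat C n) (hd : d = mkDat n (Units.map (f : A →* C) q) (Units.map (f : A →* C) t)) :
    d.B1 * d.B2 * d.B1 = d.B2 * d.B1 * d.B2 := by
  have e1 : (mkDat n q t).B1.map f = d.B1 := by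
    subst hd
    ext p t'; simp only [L1, Matrix.map_apply, Matrix.of_apply, apply_ite f, map_zero, mkDat_map]
  have e2 : (mkDat n q t).B2.map f = d.B2 := by
    subst hd
    ext p t'; simp only [L2, Matrix.map_apply, Matrix.of_apply, apply_ite f, map_zero, mkDat_map]
  have := congrArg (fun N : Matrix (T3 n) (T3 n) A => N.map f) h
  simp only [Matrix.map_mul, e1, e2] at this
  exact this

open LaurentPolynomial in
lemma braid_K {F : Type*} [Field F] (q t : Fˣ) :
    (mkDat n q t).B1 * (mkDat n q t).B2 * (mkDat n q t).B1 = (mkDat n q t).B2 * (mkDat n q t).B1 * (mkDat n q t).B2 := by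
  let qL : (LaurentPolynomial F)ˣ := ⟨T 1, T (-1), by rw [← T_add]; simp, by rw [← T_add]; simp⟩
  let tL : (LaurentPolynomial F)ˣ := Units.map (LaurentPolynomial.C : F →+* LaurentPolynomial F) t
  let ev : F → F → Fˣ → (LaurentPolynomial F →+* F) := fun _ _ x => LaurentPolynomial.eval₂ (RingHom.id F) x
  have hnz : (T 1 : LaurentPolynomial F) - 1 ≠ 0 := by
    intro h
    have h2 : Polynomial.toLaurent (Polynomial.X - 1 : Polynomial F) = Polynomial.toLaurent 0 := by
      rw [map_sub, Polynomial.toLaurent_X, map_one, map_zero, h]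
    have h3 := Polynomial.toLaurent_injective h2
    have h4 := congrArg (Polynomial.eval 0) h3
    simp at h4
  have hnu : ¬ IsUnit ((T 1 : LaurentPolynomial F) - 1) := by
    intro h
    have := h.map (LaurentPolynomial.eval₂ (RingHom.id F) (1 : Fˣ))
    simp at this
  have hN : IsNoetherianRing (LaurentPolynomial F) := 
    IsLocalization.isNoetherianRing (Submonoid.powers (Polynomial.X : Polynomial F)) _ inferInstance
  refine braid_map (LaurentPolynomial.eval₂ (RingHom.id F) q) qL tL ?_ _ ?_
  · refine braid_sep _ hnz ?_
    intro x hx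
    have hI : Ideal.span {((T 1 : LaurentPolynomial F) - 1)} ≠ ⊤ := by
      rwa [Ne, Ideal.span_singleton_eq_top]
    have := Ideal.iInf_pow_eq_bot_of_isDomain _ hI
    rw [← Ideal.mem_bot, ← this]
    simp only [Ideal.mem_iInf, Ideal.span_singleton_pow, Ideal.mem_span_singleton]
    exact hx
  · congr 1
    · ext; simp [qL]
    · ext; simp [tL]
end YB

namespace YB
set_option linter.all false
section BMW
variable {F R : Type*} [Field F] [Ring R] [Algebra F R]

structure BMW (m l : F) (b1 b2 e1 e2 : R) : Prop where
  sk1 : b1 * b1 = 1 + m • b1 + (-(m * l)) • e1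
  sk2 : b2 * b2 = 1 + m • b2 + (-(m * l)) • e2
  be1 : b1 * e1 = l • e1
  be2 : b2 * e2 = l • e2
  eb1 : e1 * b1 = l • e1
  eb2 : e2 * b2 = l • e2
  bbe1 : b1 * b2 * e1 = e2 * e1
  bbe2 : b2 * b1 * e2 = e1 * e2
  ebb1 : e1 * b2 * b1 = e1 * e2
  ebb2 : e2 * b1 * b2 = e2 * e1
  eee1 : e1 * e2 * e1 = e1
  eee2 : e2 * e1 * e2 = e2
  br : b1 * b2 * b1 = b2 * b1 * b2

variable {m l : F} {b1 b2 e1 e2 : R}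

lemma BMW.swap (h : BMW m l b1 b2 e1 e2) : BMW m l b2 b1 e2 e1 :=
  ⟨h.sk2, h.sk1, h.be2, h.be1, h.eb2, h.eb1, h.bbe2, h.bbe1, h.ebb2, h.ebb1, h.eee2, h.eee1, h.br.symm⟩

lemma BMW.ee (h : BMW m l b1 b2 e1 e2) (hm : m ≠ 0) (hl : l ≠ 0) :
    e1 * e1 = ((1 + m * l - l ^ 2) / (m * l)) • e1 := by
  have h1 := congrArg (fun x => x * e1) h.sk1
  simp only [add_mul, mul_assoc, h.be1, one_mul, smul_mul_assoc, mul_smul_comm, smul_smul] at h1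
  have h2 : (m * l) • (e1 * e1) = (1 + m * l - l^2) • e1 := by
    have h3 : (m * l) • (e1 * e1) = (1 + m * l) • e1 - (e1 + (m * l) • e1 + (-(m * l)) • (e1 * e1)) := by module
    rw [h3, ← h1]; module
  rw [div_eq_inv_mul, mul_smul, ← h2, smul_smul, inv_mul_cancel₀ (mul_ne_zero hm hl), one_smul]

lemma BMW.ebe (h : BMW m l b1 b2 e1 e2) (hl : l ≠ 0) : e1 * b2 * e1 = l⁻¹ • e1 := by
  have h1 : e1 * b2 * b1 * e1 = e1 := by rw [h.ebb1, h.eee1]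
  rw [mul_assoc, h.be1, mul_smul_comm] at h1
  conv_rhs => rw [← h1]
  rw [smul_smul, inv_mul_cancel₀ hl, one_smul]

lemma BMW.invL (h : BMW m l b1 b2 e1 e2) : (b1 - m • 1 + m • e1) * b1 = 1 := by
  simp only [add_mul, sub_mul, smul_mul_assoc, h.sk1, h.eb1, one_mul]
  module

lemma BMW.invR (h : BMW m l b1 b2 e1 e2) : b1 * (b1 - m • 1 + m • e1) = 1 := by
  simp only [mul_add, mul_sub, mul_smul_comm, h.sk1, h.be1, mul_one]
  module

lemma BMW.bee (h : BMW m l b1 b2 e1 e2) : b1 * e2 * e1 = b2 * e1 - m • e1 + m • (e2 * e1) := by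
  have h1 : b2 * (b1 * e2 * e1) = e1 := by
    rw [← mul_assoc, ← mul_assoc, h.bbe2, h.eee1]
  have h2 := congrArg (fun x => (b2 - m • 1 + m • e2) * x) h1
  simp only [← mul_assoc (b2 - m • 1 + m • e2), h.swap.invL, one_mul] at h2
  rw [h2]
  simp only [add_mul, sub_mul, smul_mul_assoc, one_mul]

lemma BMW.eeb (h : BMW m l b1 b2 e1 e2) : e1 * e2 * b1 = e1 * b2 - m • e1 + m • (e1 * e2) := by
  have h1 : e1 * e2 * b1 * b2 = e1 := by
    rw [mul_assoc, mul_assoc, ← mul_assoc e2, h.ebb2, ← mul_assoc, h.eee1]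
  have h2 := congrArg (fun x => x * (b2 - m • 1 + m • e2)) h1
  simp only [mul_assoc _ b2, h.swap.invR, mul_one] at h2
  rw [h2]
  simp only [mul_add, mul_sub, mul_smul_comm, mul_one]

lemma BMW.beb (h : BMW m l b1 b2 e1 e2) : b2 * e1 * b2 =
    b1 * e2 * b1 - m • (b1 * e2) - m • (e2 * b1) + m • (b2 * e1 - m • e1 + m • (e2 * e1))
     + m • (e1 * b2 - m • e1 + m • (e1 * e2)) + m^2 • e2 - m^2 • (e2 * e1) - m^2 • (e1 * e2) + m^2 • e1 := by
  have h1 : b1 * (b2 * e1 * b2) * b1 = e2 := by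
    have : b1 * (b2 * e1 * b2) * b1 = (b1 * b2 * e1) * b2 * b1 := by noncomm_ring
    rw [this, h.bbe1, mul_assoc, mul_assoc, ← mul_assoc e1, h.ebb1, ← mul_assoc, h.eee2]
  have h2 := congrArg (fun x => (b1 - m • 1 + m • e1) * x * (b1 - m • 1 + m • e1)) h1
  have h3 : (b1 - m • 1 + m • e1) * (b1 * (b2 * e1 * b2) * b1) * (b1 - m • 1 + m • e1)
     = ((b1 - m • 1 + m • e1) * b1) * (b2 * e1 * b2) * (b1 * (b1 - m • 1 + m • e1)) := by
    simp only [mul_assoc]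
  simp only [h3, h.invL, h.invR, one_mul, mul_one] at h2
  rw [h2]
  simp only [mul_add, mul_sub, add_mul, sub_mul, smul_mul_assoc, mul_smul_comm, mul_one, one_mul, h.eee1, h.bee, h.eeb]
  module

def Xp (q ξ : F) (b e : R) (z : F) : R :=
  b + ((q - q⁻¹) / (z - 1)) • 1 - ((q - q⁻¹) * ξ / (z - ξ)) • e

set_option maxHeartbeats 4000000 in
lemma baxter (q ξ : F) (hq : q ≠ 0) (hm : q - q⁻¹ ≠ 0) (hξ : ξ ≠ 0)
    (h : BMW (q - q⁻¹) (-(q * ξ)) b1 b2 e1 e2) (z w : F)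
    (z1 : z - 1 ≠ 0) (w1 : w - 1 ≠ 0) (zw1 : z * w - 1 ≠ 0)
    (z2 : z - ξ ≠ 0) (w2 : w - ξ ≠ 0) (zw2 : z * w - ξ ≠ 0) :
    Xp q ξ b2 e2 z * Xp q ξ b1 e1 (z * w) * Xp q ξ b2 e2 w
      = Xp q ξ b1 e1 w * Xp q ξ b2 e2 (z * w) * Xp q ξ b1 e1 z := by
  have hl : -(q * ξ) ≠ 0 := neg_ne_zero.2 (mul_ne_zero hq hξ)
  unfold Xp
  obtain ⟨v, hv⟩ : ∃ v, v = z * w := ⟨_, rfl⟩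
  rw [← hv] at zw1 zw2 ⊢
  simp only [mul_add, mul_sub, add_mul, sub_mul, smul_mul_assoc, mul_smul_comm, mul_one, one_mul]
  simp only [h.eee1, h.eee2, h.bee, h.swap.bee, h.eeb, h.swap.eeb, h.beb, ← h.br, h.ebe hl, h.swap.ebe hl,
    h.ee hm hl, h.swap.ee hm hl, h.sk1, h.sk2, h.be1, h.be2, h.eb1, h.eb2, h.bbe1, h.bbe2, h.ebb1, h.ebb2]
  have hm2 : q ^ 2 - 1 ≠ 0 := by
    intro h0; apply hm; field_simp; rw [h0]; simp
  match_scalars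
  all_goals (try field_simp)
  all_goals (try rw [hv])
  all_goals ring1
end BMW
end YB

open Finset
open scoped Kronecker
namespace YB
set_option linter.all false

lemma sum_pick {F : Type*} [AddCommMonoid F] (S : Finset ℕ) (T : ℕ → Finset ℕ) (i0 j0 : ℕ) (f : ℕ → ℕ → F) :
    ∑ i ∈ S, ∑ j ∈ T i, (if i = i0 ∧ j = j0 then f i j else 0) = if i0 ∈ S ∧ j0 ∈ T i0 then f i0 j0 else 0 := by
  simp only [ite_and]
  have : ∀ i, ∑ j ∈ T i, (if i = i0 then (if j = j0 then f i j else 0) else 0) = if i = i0 then (if j0 ∈ T i0 then f i0 j0 else 0) else 0 := by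
    intro i
    split_ifs with h h1
    · subst h; rw [sum_ite_eq', if_pos h1]
    · subst h; rw [sum_ite_eq', if_neg h1]
    · simp
  simp only [this, sum_ite_eq']

variable {n : ℕ} (a b c e : Fin (2*n))

lemma k1 (i j : ℕ) : (E n i i ⊗ₖ E n j j) (a,b) (c,e) = if i = a.val + 1 ∧ j = b.val + 1 then (if a = c ∧ b = e then 1 else 0) else 0 := by
  simp only [Matrix.kroneckerMap_apply, E, Matrix.of_apply, Fin.ext_iff]
  split_ifs <;> first | (exfalso; omega) | simp
lemma k2 (i j : ℕ) : (E n j j ⊗ₖ E n i i) (a,b) (c,e) = if i = b.val + 1 ∧ j = a.val + 1 then (if a = c ∧ b = e then 1 else 0) else 0 := by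
  simp only [Matrix.kroneckerMap_apply, E, Matrix.of_apply, Fin.ext_iff]
  split_ifs <;> first | (exfalso; omega) | simp
lemma k3 (i j : ℕ) : (E n i j ⊗ₖ E n j i) (a,b) (c,e) = if i = a.val + 1 ∧ j = b.val + 1 then (if e = a ∧ c = b then 1 else 0) else 0 := by
  simp only [Matrix.kroneckerMap_apply, E, Matrix.of_apply, Fin.ext_iff]
  split_ifs <;> first | (exfalso; omega) | simp
lemma k4 (f : ℕ → ℕ → K) (i j : ℕ) : (f i j • (E n (2*n+1-i) (2*n+1-j) ⊗ₖ E n i j)) (a,b) (c,e) = if i = b.val + 1 ∧ j = e.val + 1 then (if b = a.rev ∧ e = c.rev then f i j else 0) else 0 := by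
  simp only [Matrix.smul_apply, Matrix.kroneckerMap_apply, E, Matrix.of_apply, Fin.ext_iff, Fin.val_rev]
  have := a.2
  have := b.2
  have := c.2
  have := e.2
  split_ifs <;> first | (exfalso; omega) | simp

lemma d1 (S : Finset ℕ) (T : ℕ → Finset ℕ) : ∑ i ∈ S, ∑ j ∈ T i, (E n i i ⊗ₖ E n j j) (a,b) (c,e) =
    if a.val + 1 ∈ S ∧ b.val + 1 ∈ T (a.val + 1) then (if a = c ∧ b = e then 1 else 0) else 0 := by
  simp only [k1]
  exact sum_pick S T _ _ (fun _ _ => _)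
lemma d2 (S : Finset ℕ) (T : ℕ → Finset ℕ) : ∑ i ∈ S, ∑ j ∈ T i, (E n j j ⊗ₖ E n i i) (a,b) (c,e) =
    if b.val + 1 ∈ S ∧ a.val + 1 ∈ T (b.val + 1) then (if a = c ∧ b = e then 1 else 0) else 0 := by
  rw [← sum_pick S T _ _ (fun _ _ => if a = c ∧ b = e then (1:K) else 0)]
  refine sum_congr rfl fun i _ => sum_congr rfl fun j _ => ?_
  rw [k2]

lemma S1_apply : S1 n (a,b) (c,e) = if a = c ∧ b = e then (if cond n a b then 1 else 0) else 0 := by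
  unfold S1
  have k1' : ∀ j : ℕ, (E n n n ⊗ₖ E n j j) (a,b) (c,e) = if j = b.val + 1 then (if a = c ∧ b = e ∧ n = a.val + 1 then 1 else 0) else 0 := by
    intro j; rw [k1]; simp only [Fin.ext_iff]
    split_ifs <;> first | (exfalso; omega) | rfl
  simp only [Matrix.add_apply, Matrix.sum_apply]
  rw [d1 a b c e _ (fun i => Icc (i+1) n), d1 a b c e _ (fun i => Icc (2*n+1-i+1) (2*n)),
    d2 a b c e _ (fun i => Icc (i+1) (2*n)), d2 a b c e _ (fun i => Icc (n+1) (2*n-i))]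
  simp only [k1', sum_ite_eq']
  by_cases h : a = c ∧ b = e
  · have := a.2
    have := b.2
    obtain ⟨rfl, rfl⟩ := h
    clear k1'
    simp only [mem_Icc, true_and, if_true, and_self]
    by_cases h : cond n a b
    · simp only [if_pos h]
      unfold cond at h
      split_ifs <;> first | (exfalso; omega) | simp
    · simp only [if_neg h]
      unfold cond at h
      split_ifs <;> first | (exfalso; omega) | simp
  · have h2 : ¬ (a = c ∧ b = e ∧ n = a.val + 1) := fun h' => h ⟨h'.1, h'.2.1⟩
    simp [h, h2]

lemma S2_apply : S2 n (a,b) (c,e) = if a = c ∧ b = e then (if cond n b a then 1 else 0) else 0 := by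
  have h := S1_apply b a e c
  simp only [and_comm (a := b = e)] at h
  have : S2 n (a,b) (c,e) = S1 n (b,a) (e,c) := by
    unfold S1 S2
    simp only [Matrix.add_apply, Matrix.sum_apply, Matrix.kroneckerMap_apply, mul_comm]
  rw [this, h]

lemma P_apply : Pmat n (a,b) (c,e) = if e = a ∧ c = b then 1 else 0 := by
  unfold Pmat
  simp only [Matrix.sum_apply, k3, sum_pick _ (fun i => Icc 1 (2*n))]
  rw [if_pos]
  have := a.2
  have := b.2
  simp only [mem_Icc]; omega

lemma reassoc6 (a b c d e f : K) : a + b + c + d + e + f = a + (b + c) + (d + e) + f := by ring1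

lemma Rbar_apply (z : K) : Rbar n z (a,b) (c,e) =
    (if a = b ∧ a = c ∧ a = e then 1 else 0)
    + (if a = c ∧ b = e then (if cond n a b then r * s * (z - 1) / (z * r - s) else if cond n b a then (z - 1) / (z * r - s) else 0) else 0)
    + (if e = a ∧ c = b ∧ b ≠ a.rev then (if b < a then (r - s) / (z * r - s) else if a < b then (r - s) * z / (z * r - s) else 0) else 0)
    + (if b = a.rev ∧ e = c.rev then 1 / ((z - r⁻¹ * s) * (z - nExp n)) * aC n z (b.val+1) (e.val+1) else 0) := by
  unfold Rbar
  have ha := a.2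
  have hb := b.2
  have he := e.2
  have hc := c.2
  have k5 : ∀ i j : ℕ, (if i ≠ 2*n+1-j then E n i j ⊗ₖ E n j i else 0) (a,b) (c,e) = if i = a.val + 1 ∧ j = b.val + 1 then (if e = a ∧ c = b ∧ b ≠ a.rev then 1 else 0) else 0 := by
    intro i j
    have : (if i ≠ 2*n+1-j then E n i j ⊗ₖ E n j i else 0) (a,b) (c,e) = if i ≠ 2*n+1-j then (E n i j ⊗ₖ E n j i) (a,b) (c,e) else 0 := by
      split_ifs <;> rfl
    rw [this, k3]
    simp only [ne_eq, Fin.ext_iff, Fin.val_rev]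
    split_ifs <;> first | (exfalso; omega) | rfl
  simp only [Matrix.add_apply, Matrix.smul_apply, Matrix.sum_apply, k5, k4 a b c e (aC n z)]
  have k6 : ∑ i ∈ Icc 1 (2*n), (E n i i ⊗ₖ E n i i) (a,b) (c,e) = if a = b ∧ a = c ∧ a = e then (1:K) else 0 := by
    have : ∀ i, (E n i i ⊗ₖ E n i i) (a,b) (c,e) = if i = a.val + 1 then (if a = b ∧ a = c ∧ a = e then (1:K) else 0) else 0 := by
      intro i; rw [k1]; simp only [Fin.ext_iff]
      split_ifs <;> first | (exfalso; omega) | rfl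
    simp only [this, sum_ite_eq']
    rw [if_pos]; simp only [mem_Icc]; omega
  rw [k6, S1_apply, S2_apply]
  simp only [sum_pick _ (fun i => Icc 1 (2*n)), sum_pick _ (fun i => Icc (i+1) (2*n)), sum_pick _ (fun i => Icc 1 (i-1)), mem_Icc, smul_eq_mul]
  have hcond : ¬ (cond n a b ∧ cond n b a) := by unfold cond; omega
  rw [if_pos (show (1 ≤ b.val + 1 ∧ b.val + 1 ≤ 2 * n) ∧ 1 ≤ e.val + 1 ∧ e.val + 1 ≤ 2*n by omega)]
  refine (reassoc6 _ _ _ _ _ _).trans ?_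
  refine congrArg₂ (· + ·) (congrArg₂ (· + ·) (congrArg₂ (· + ·) rfl ?_) ?_) ?_
  · split_ifs <;> first | (exfalso; tauto) | ring1
  · simp only [Fin.lt_def]
    split_ifs <;> first | (exfalso; omega) | ring1
  · rw [mul_ite, mul_zero]
end YB

open Finset
open scoped Kronecker
namespace YB
set_option linter.all false

section
variable {F : Type*} [Field F] (x y z ξ v : F)
lemma sc1 (hx : x ≠ 0) (hy : y ≠ 0) (h1 : z - 1 ≠ 0) (h2 : z * x^2 - y^2 ≠ 0) : x * y * (z-1) / (z*x^2-y^2) * (x*y⁻¹ + (x*y⁻¹ - (x*y⁻¹)⁻¹)/(z-1)) = 1 := by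
  field_simp
  rw [div_eq_one_iff_eq (by rwa [mul_comm])]; ring1
lemma sc2 (hx : x ≠ 0) (hy : y ≠ 0) (h1 : z - 1 ≠ 0) (h2 : z * x^2 - y^2 ≠ 0) : x * y * (z-1) / (z*x^2-y^2) * ((x*y⁻¹ - (x*y⁻¹)⁻¹)/(z-1)) = (x^2-y^2)/(z*x^2-y^2) := by
  field_simp
lemma sc3 (hx : x ≠ 0) (hy : y ≠ 0) (h1 : z - 1 ≠ 0) (h2 : z * x^2 - y^2 ≠ 0) : x * y * (z-1) / (z*x^2-y^2) * ((x*y⁻¹ - (x*y⁻¹)⁻¹) + (x*y⁻¹ - (x*y⁻¹)⁻¹)/(z-1)) = (x^2-y^2)*z/(z*x^2-y^2) := by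
  field_simp; ring1
lemma sc0 (hx : x ≠ 0) (h2 : z * x^2 - y^2 ≠ 0) (h3 : z - ξ ≠ 0) : 1 / ((z - (x^2)⁻¹ * y^2) * (z - ξ)) = x^2/((z*x^2-y^2)*(z-ξ)) := by
  rw [show z - (x^2)⁻¹ * y^2 = (z*x^2-y^2)/x^2 by field_simp]
  field_simp
lemma sc4 (hx : x ≠ 0) (hy : y ≠ 0) (h1 : z - 1 ≠ 0) (h2 : z * x^2 - y^2 ≠ 0) (h3 : z - ξ ≠ 0) : x * y * (z-1) / (z*x^2-y^2) * ((x*y⁻¹)⁻¹ - (x*y⁻¹ - (x*y⁻¹)⁻¹)*ξ/(z-ξ)) = 1 / ((z - (x^2)⁻¹ * y^2) * (z - ξ)) * ((z - 1) * ((x^2)⁻¹ * y^2 * z - ξ)) := by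
  rw [sc0 x y z ξ hx h2 h3]
  field_simp; ring1
lemma sc5 (hx : x ≠ 0) (hy : y ≠ 0) (h1 : z - 1 ≠ 0) (h2 : z * x^2 - y^2 ≠ 0) (h3 : z - ξ ≠ 0) (t : F) : x * y * (z-1) / (z*x^2-y^2) * (t * ((x*y⁻¹ - (x*y⁻¹)⁻¹) + (x*y⁻¹ - (x*y⁻¹)⁻¹)/(z-1)) - (x*y⁻¹ - (x*y⁻¹)⁻¹) * v - (x*y⁻¹ - (x*y⁻¹)⁻¹)*ξ/(z-ξ) * v) = 1 / ((z - (x^2)⁻¹ * y^2) * (z - ξ)) * (((x^2)⁻¹ * y^2 - 1) * z * (v * (z - 1) - t * (z - ξ))) := by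
  rw [sc0 x y z ξ hx h2 h3]
  field_simp; ring1
lemma sc6 (hx : x ≠ 0) (hy : y ≠ 0) (h1 : z - 1 ≠ 0) (h2 : z * x^2 - y^2 ≠ 0) (h3 : z - ξ ≠ 0) (t : F) : x * y * (z-1) / (z*x^2-y^2) * (t * ((x*y⁻¹ - (x*y⁻¹)⁻¹)/(z-1)) - (x*y⁻¹ - (x*y⁻¹)⁻¹)*ξ/(z-ξ) * v) = 1 / ((z - (x^2)⁻¹ * y^2) * (z - ξ)) * (((x^2)⁻¹ * y^2 - 1) * (v * ξ * (z - 1) - t * (z - ξ))) := by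
  rw [sc0 x y z ξ hx h2 h3]
  field_simp; ring1
end

lemma uv {n : ℕ} (q : Kˣ) (a e : Fin (2*n)) : (q:K) ^ (bar n (a.val+1) - bar n (e.val+1)) * sg n (a.val+1) * sg n (e.val+1) = - (uN n q a.val * uN n q e.rev.val) := by
  have hq : (q:K) ≠ 0 := q.ne_zero
  have := a.2
  have := e.2
  unfold bar sg uN
  simp only [Fin.val_rev]
  by_cases ha : a.val < n <;> by_cases he : e.val < n
  · rw [if_pos (by omega), if_pos (by omega), if_pos (by omega), if_pos (by omega), if_pos (by omega), if_neg (by omega)]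
    rw [mul_neg, neg_neg, mul_one, mul_one, ← Units.val_mul, ← zpow_add, Units.val_zpow_eq_zpow_val]
    congr 1; push_cast; omega
  · rw [if_pos (by omega), if_neg (by omega), if_pos (by omega), if_neg (by omega), if_pos (by omega), if_pos (by omega)]
    rw [mul_neg, mul_one, mul_one, ← Units.val_mul, ← zpow_add, Units.val_zpow_eq_zpow_val]
    congr 2; push_cast; omega
  · rw [if_neg (by omega), if_pos (by omega), if_neg (by omega), if_pos (by omega), if_neg (by omega), if_neg (by omega)]
    rw [neg_mul_neg, mul_neg, mul_one, mul_one, ← Units.val_mul, ← zpow_add, Units.val_zpow_eq_zpow_val]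
    congr 2; push_cast; omega
  · rw [if_neg (by omega), if_neg (by omega), if_neg (by omega), if_neg (by omega), if_neg (by omega), if_pos (by omega)]
    rw [neg_mul, neg_neg, mul_neg, mul_neg, neg_mul, neg_neg, mul_one, mul_one, ← Units.val_mul, ← zpow_add, Units.val_zpow_eq_zpow_val]
    congr 1; push_cast; omega

lemma alg_ne {p : MvPolynomial (Fin 4) ℚ} (v : Fin 4 → ℚ) (h : MvPolynomial.eval v p ≠ 0) : algebraMap (MvPolynomial (Fin 4) ℚ) K p ≠ 0 := by
  intro h0
  rw [← map_zero (algebraMap (MvPolynomial (Fin 4) ℚ) K)] at h0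
  have := IsFractionRing.injective (MvPolynomial (Fin 4) ℚ) K h0
  rw [this] at h; simp at h

lemma rho_ne : ρ ≠ 0 := alg_ne (fun _ => 1) (by simp)
lemma sig_ne : σ' ≠ 0 := alg_ne (fun _ => 1) (by simp)

def qU : Kˣ := Units.mk0 (ρ * σ'⁻¹) (mul_ne_zero rho_ne (inv_ne_zero sig_ne))
def tU : Kˣ := Units.mk0 (ρ * σ') (mul_ne_zero rho_ne sig_ne)
lemma qU_val : (qU : K) = ρ * σ'⁻¹ := rfl
lemma tU_val : (tU : K) = ρ * σ' := rfl

abbrev dC (n : ℕ) : Dat K n := mkDat n qU tU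

def X4 (n : ℕ) (z : K) (a b c e : Fin (2*n)) : K :=
  (dC n).B a b c e + (ρ * σ'⁻¹ - (ρ * σ'⁻¹)⁻¹)/(z-1) * one4 a b c e - (ρ * σ'⁻¹ - (ρ * σ'⁻¹)⁻¹) * nExp n/(z-nExp n) * (dC n).E a b c e

lemma cond_or {n : ℕ} (a b : Fin (2*n)) (h1 : a ≠ b) (h2 : b ≠ a.rev) : ¬ cond n a b → cond n b a := by
  have := a.2
  have := b.2
  simp only [ne_eq, Fin.ext_iff, Fin.val_rev] at h1 h2
  unfold cond; omega
lemma cond_not {n : ℕ} (a b : Fin (2*n)) : cond n a b → ¬ cond n b a := by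
  unfold cond; omega
lemma cond_rev {n : ℕ} (a b : Fin (2*n)) (h : b = a.rev) : ¬ cond n a b := by
  subst h; have := a.2; simp only [Fin.val_rev]; unfold cond; omega
lemma cond_self {n : ℕ} (a : Fin (2*n)) : ¬ cond n a a := by
  unfold cond; omega

lemma Rb_rev {n : ℕ} (z : K) (h1 : z - 1 ≠ 0) (h2 : z * r - s ≠ 0) (h3 : z - nExp n ≠ 0) (a c e : Fin (2*n)) :
    Rbar n z (a.rev,a) (c,e) = ρ * σ' * (z-1)/(z * r - s) * X4 n z a a.rev c e := by
  have hx := rho_ne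
  have hy := sig_ne
  unfold r s at h2
  have ra := rev_ne a
  rw [Rbar_apply]
  rw [if_neg (by tauto), if_neg (cond_rev _ _ (by simp)), if_neg (cond_rev _ _ (by simp)), ite_self,
    if_neg (show ¬ (e = a.rev ∧ c = a ∧ a ≠ a.rev.rev) by simp)]
  by_cases he : e = c.rev
  · obtain rfl : c = e.rev := by rw [he]; simp
    rw [if_pos (by simp)]
    simp only [X4, Dat.B, one4, Dat.E, Dat.U, Fin.rev_rev, if_true, true_and]
    have hD : (dC n).D a.rev a = (ρ * σ'⁻¹)⁻¹ := by
      simp only [mkDat, DN]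
      rw [if_neg ra.symm, if_pos (by simp), Units.val_inv_eq_inv_val, qU_val]
    have hm : (dC n).q - (dC n).qi = ρ * σ'⁻¹ - (ρ * σ'⁻¹)⁻¹ := by
      simp only [mkDat]; rw [Units.val_inv_eq_inv_val, qU_val]
    have huv := uv qU a e
    have hv : (dC n).u a * (dC n).u e.rev = - ((ρ * σ'⁻¹) ^ (bar n (a.val+1) - bar n (e.val+1)) * sg n (a.val+1) * sg n (e.val+1)) := by
      rw [← qU_val, huv, neg_neg]; rfl
    rw [mul_assoc ((dC n).q - (dC n).qi), hv, hm, hD]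
    have e1 : (e.rev = a.rev ∧ e = a) ↔ e = a := by rw [Fin.rev_inj]; simp
    have e2 : (e.rev = a ∧ e = a.rev) ↔ e = a.rev := by
      constructor
      · exact fun h => h.2
      · rintro rfl; simp
    have e3 : (a = e.rev ∧ a.rev = e) ↔ e = a.rev := by
      constructor
      · exact fun h => h.2.symm
      · rintro rfl; simp
    simp only [e1, e2, e3, Fin.rev_lt_rev]
    rw [zero_add, zero_add, zero_add]
    generalize hV : (ρ * σ'⁻¹) ^ (bar n (a.val+1) - bar n (e.val+1)) * sg n (a.val+1) * sg n (e.val+1) = V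
    unfold aC
    rw [hV]
    unfold r s
    have ve := e.2
    have va := a.2
    have g1 : (a.val + 1 = e.val + 1) ↔ e = a := by rw [Fin.ext_iff]; omega
    have g2 : (e.val + 1 < a.val + 1) ↔ e < a := by rw [Fin.lt_def]; omega
    have g3 : (a.val + 1 = 2 * n + 1 - (e.val + 1)) ↔ e = a.rev := by rw [Fin.ext_iff, Fin.val_rev]; omega
    simp only [g1, g2, g3]
    by_cases h : e = a
    · have h4 : ¬ e = a.rev := by rw [h]; exact ra.symm
      have h5 : ¬ e < a := by rw [h]; exact lt_irrefl _
      have hV1 : V = 1 := by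
        rw [← hV, h, sub_self, zpow_zero]; unfold sg; split_ifs <;> simp
      simp only [if_pos h, if_neg h4, if_neg h5]
      rw [← sc4 ρ σ' z (nExp n) hx hy h1 h2 h3, hV1]; ring1
    · simp only [if_neg h]
      by_cases h5 : e < a
      · simp only [if_pos h5]
        rw [← sc5 ρ σ' z (nExp n) V hx hy h1 h2 h3]
        congr 1
        by_cases h4 : e = a.rev
        · have h6 : a.rev < a := by rw [← h4]; exact h5
          simp only [if_pos h4, if_pos h6]; ring1
        · simp only [if_neg h4]; ring1
      · simp only [if_neg h5]
        rw [← sc6 ρ σ' z (nExp n) V hx hy h1 h2 h3]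
        congr 1
        by_cases h4 : e = a.rev
        · have h6 : ¬ a.rev < a := by rw [← h4]; exact h5
          simp only [if_pos h4, if_neg h6]; ring1
        · simp only [if_neg h4]; ring1
  · rw [if_neg (by tauto)]
    have c1 : ¬ (c = a.rev ∧ e = a) := by rintro ⟨rfl, rfl⟩; simp at he
    have c2 : ¬ (c = a ∧ e = a.rev) := by rintro ⟨rfl, rfl⟩; simp at he
    have c3 : ¬ (a = c ∧ a.rev = e) := by rintro ⟨rfl, rfl⟩; simp at he
    simp only [X4, Dat.B, one4, Dat.E, Dat.U, if_neg he, if_neg c1, if_neg c2, if_neg c3]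
    simp

lemma Rb_gen {n : ℕ} (z : K) (h1 : z - 1 ≠ 0) (h2 : z * r - s ≠ 0) (h3 : z - nExp n ≠ 0) (a b c e : Fin (2*n)) (hb : b ≠ a.rev) :
    Rbar n z (b,a) (c,e) = ρ * σ' * (z-1)/(z * r - s) * X4 n z a b c e := by
  have hx := rho_ne
  have hy := sig_ne
  unfold r s at h2
  have hb' : a ≠ b.rev := by rintro rfl; simp at hb
  have hm : (dC n).q - (dC n).qi = ρ * σ'⁻¹ - (ρ * σ'⁻¹)⁻¹ := by
    simp only [mkDat]; rw [Units.val_inv_eq_inv_val, qU_val]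
  rw [Rbar_apply]
  simp only [X4, Dat.B, one4, Dat.E, Dat.U, if_neg hb, hb, hb', false_and, if_false, ite_self, add_zero, zero_mul, neg_zero, mul_zero, sub_zero, ne_eq, not_false_eq_true, and_true, hm]
  unfold r s
  by_cases hab : a = b
  · subst hab
    simp only [if_neg (cond_self a), ite_self, lt_irrefl, if_false, add_zero, true_and]
    have hD : (dC n).D a a = ρ * σ'⁻¹ := (dC n).Daa a
    rw [hD]
    by_cases h : c = a ∧ e = a
    · obtain ⟨rfl, rfl⟩ := h
      simp only [and_self, if_true]
      rw [mul_one, sc1 _ _ _ hx hy h1 h2]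
    · have h' : ¬ (e = a ∧ c = a) := by tauto
      have h'' : ¬ (a = c ∧ a = e) := by rintro ⟨rfl, rfl⟩; exact h ⟨rfl, rfl⟩
      simp only [if_neg h, if_neg h', if_neg h'']; ring1
  · rw [if_neg (by rintro ⟨h, -⟩; exact hab h.symm)]
    by_cases h : c = b ∧ e = a
    · obtain ⟨rfl, rfl⟩ := h
      have g1 : ¬ (e = c ∧ c = e) := fun h => hab h.1
      have g2 : ¬ (c = e ∧ e = c) := fun h => hab h.2
      simp only [and_self, if_true, if_neg g1, if_neg g2]
      simp only [mkDat, DN]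
      rw [if_neg hab, if_neg hb']
      by_cases hc : cond n c e
      · rw [if_pos hc, if_pos hc, tU_val]; ring1
      · rw [if_neg hc, if_neg hc, if_pos (cond_or _ _ (Ne.symm hab) hb' hc), Units.val_inv_eq_inv_val, tU_val]
        field_simp
        ring1
    · rw [if_neg (by tauto), if_neg h]
      by_cases h' : c = a ∧ e = b
      · obtain ⟨rfl, rfl⟩ := h'
        simp only [and_self, if_true]
        rcases lt_or_gt_of_ne hab with hl | hl
        · rw [if_pos hl, if_neg (not_lt.mpr hl.le), ← sc2 _ _ _ hx hy h1 h2]; ring1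
        · rw [if_neg (not_lt.mpr hl.le), if_pos hl, if_pos hl, ← sc3 _ _ _ hx hy h1 h2]; ring1
      · rw [if_neg (by tauto), if_neg h', if_neg (by tauto)]; ring1

lemma Rb {n : ℕ} (z : K) (h1 : z - 1 ≠ 0) (h2 : z * r - s ≠ 0) (h3 : z - nExp n ≠ 0) (a b c e : Fin (2*n)) :
    Rbar n z (b,a) (c,e) = ρ * σ' * (z-1)/(z * r - s) * X4 n z a b c e := by
  by_cases hb : b = a.rev
  · subst hb; exact Rb_rev z h1 h2 h3 a c e
  · exact Rb_gen z h1 h2 h3 a b c e hb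
end YB

open Finset
open scoped Kronecker
namespace YB
set_option linter.all false

variable {n : ℕ}

lemma lift12_eq (X : M2 n) : lift12 n X = L1 (fun a b c e => X (a,b) (c,e)) := by
  ext ⟨a, b, c⟩ ⟨x, y, z⟩
  simp [lift12, L1, Matrix.one_apply]
lemma lift23_eq (X : M2 n) : lift23 n X = L2 (fun a b c e => X (a,b) (c,e)) := by
  ext ⟨a, b, c⟩ ⟨x, y, z⟩
  simp [lift23, L2, Matrix.one_apply]

lemma sum_two (f : Fin (2*n) → Fin (2*n) → K) (a b : Fin (2*n)) : ∑ x, ∑ y, (if y = a ∧ x = b then 1 else 0) * f x y = f b a := by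
  have : ∀ x y, (if y = a ∧ x = b then (1:K) else 0) * f x y = if x = b then (if y = a then f b a else 0) else 0 := by
    intro x y
    by_cases h1 : x = b <;> by_cases h2 : y = a <;> simp [h1, h2]
  simp [this]

abbrev p1 (n : ℕ) := lift12 n (Pmat n)
abbrev p2 (n : ℕ) := lift23 n (Pmat n)

lemma p1_mul (N : Matrix (T3 n) (T3 n) K) (a b c : Fin (2*n)) (t : T3 n) : (p1 n * N) (a,b,c) t = N (b,a,c) t := by
  rw [p1, lift12_eq, L1_mul]
  simp only [P_apply]
  exact sum_two (fun x y => N (x, y, c) t) a b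
lemma p2_mul (N : Matrix (T3 n) (T3 n) K) (a b c : Fin (2*n)) (t : T3 n) : (p2 n * N) (a,b,c) t = N (a,c,b) t := by
  rw [p2, lift23_eq, L2_mul]
  simp only [P_apply]
  exact sum_two (fun x y => N (a, x, y) t) b c
lemma mul_p1 (N : Matrix (T3 n) (T3 n) K) (a b c : Fin (2*n)) (t : T3 n) : (N * p1 n) t (a,b,c) = N t (b,a,c) := by
  rw [p1, lift12_eq, mul_L1]
  simp only [P_apply, mul_comm (N _ _)]
  simp only [eq_comm (a := b), eq_comm (a := a), and_comm (b := _ = a)]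
  simp only [and_comm (a := _ = a)]
  rw [← sum_two (fun x y => N t (x, y, c)) a b]
  refine sum_congr rfl fun x _ => sum_congr rfl fun y _ => ?_
  congr 1
  simp only [and_comm]
lemma mul_p2 (N : Matrix (T3 n) (T3 n) K) (a b c : Fin (2*n)) (t : T3 n) : (N * p2 n) t (a,b,c) = N t (a,c,b) := by
  rw [p2, lift23_eq, mul_L2]
  simp only [P_apply, mul_comm (N _ _)]
  rw [← sum_two (fun x y => N t (a, x, y)) b c]
  refine sum_congr rfl fun x _ => sum_congr rfl fun y _ => ?_
  congr 1
  simp only [eq_comm (a := b), eq_comm (a := c), and_comm]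

lemma p1p1 : p1 n * p1 n = 1 := by
  ext ⟨a, b, c⟩ ⟨x, y, z⟩
  rw [p1_mul, ← mul_one (p1 n), p1_mul]
lemma p2p2 : p2 n * p2 n = 1 := by
  ext ⟨a, b, c⟩ ⟨x, y, z⟩
  rw [p2_mul, ← mul_one (p2 n), p2_mul]
lemma pbraid : p1 n * p2 n * p1 n = p2 n * p1 n * p2 n := by
  ext ⟨a, b, c⟩ ⟨x, y, z⟩
  rw [mul_assoc, p1_mul, p2_mul, ← mul_one (p1 n), p1_mul, mul_assoc, mul_assoc, p2_mul, p1_mul, one_mul, ← mul_one (p2 n), p2_mul]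
lemma L1pp (X : Fin (2*n) → Fin (2*n) → Fin (2*n) → Fin (2*n) → K) : L1 X * p2 n * p1 n = p2 n * p1 n * L2 X := by
  ext ⟨a, b, c⟩ ⟨x, y, z⟩
  rw [mul_p1, mul_p2, mul_assoc, p2_mul, p1_mul]
  simp [L1, L2]
lemma L2pp (X : Fin (2*n) → Fin (2*n) → Fin (2*n) → Fin (2*n) → K) : L2 X * p1 n * p2 n = p1 n * p2 n * L1 X := by
  ext ⟨a, b, c⟩ ⟨x, y, z⟩
  rw [mul_p2, mul_p1, mul_assoc, p1_mul, p2_mul]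
  simp [L1, L2]

abbrev xi (n : ℕ) : K := nExp n
abbrev qK : K := ρ * σ'⁻¹

lemma q_ne : qK ≠ 0 := mul_ne_zero rho_ne (inv_ne_zero sig_ne)

lemma xi_eq : qK * nExp n = ((qU ^ (-2 * (n:ℤ) - 1) : Kˣ) : K) := by
  have hq := q_ne
  rw [Units.val_zpow_eq_zpow_val, qU_val]
  rw [show (-2 * (n:ℤ) - 1) = 1 + 2 * (-(n:ℤ)-1) by ring, zpow_add₀ hq, zpow_one, zpow_mul]
  congr 1
  unfold nExp r s
  rw [mul_zpow, mul_zpow, show ((n:ℤ)+1) = -(-(n:ℤ)-1) by ring, zpow_neg, inv_zpow, inv_zpow]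
  rfl

lemma bmw (n : ℕ) : BMW (qK - qK⁻¹) (-(qK * nExp n)) (dC n).B1 (dC n).B2 (dC n).E1 (dC n).E2 := by
  have hm : (dC n).q - (dC n).qi = qK - qK⁻¹ := by
    simp only [mkDat]; rw [Units.val_inv_eq_inv_val, qU_val]
  have hl : (dC n).l = -(qK * nExp n) := by
    rw [xi_eq]; rfl
  rw [← hm, ← hl]
  exact ⟨skein1 _, skein2 _, B1E1 _, B2E2 _, E1B1 _, E2B2 _, BBE _, BBE' _, EBB _, EBB' _, EEE _, EEE' _, braid_K _ _⟩

lemma X4_eq (z : K) : X4 n z = (dC n).B + ((qK - qK⁻¹)/(z-1)) • one4 + (-((qK - qK⁻¹) * nExp n/(z-nExp n))) • (dC n).E := by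
  funext a b c e
  simp only [X4, Pi.add_apply, Pi.smul_apply, smul_eq_mul]
  ring1
lemma L1X (z : K) : L1 (X4 n z) = Xp qK (nExp n) (dC n).B1 (dC n).E1 z := by
  rw [X4_eq, L1_add, L1_add, L1_smul, L1_smul, L1_one, Xp, neg_smul, ← sub_eq_add_neg]
lemma L2X (z : K) : L2 (X4 n z) = Xp qK (nExp n) (dC n).B2 (dC n).E2 z := by
  rw [X4_eq, L2_add, L2_add, L2_smul, L2_smul, L2_one, Xp, neg_smul, ← sub_eq_add_neg]

def cf (z : K) : K := ρ * σ' * (z-1)/(z * r - s)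

lemma lift12_R (z : K) (h1 : z - 1 ≠ 0) (h2 : z * r - s ≠ 0) (h3 : z - nExp n ≠ 0) : lift12 n (Rbar n z) = cf z • (p1 n * L1 (X4 n z)) := by
  ext ⟨a, b, c⟩ ⟨x, y, t⟩
  rw [Matrix.smul_apply, p1_mul, lift12_eq]
  simp only [L1, Matrix.of_apply, Rb z h1 h2 h3 b a, cf]
  split_ifs <;> simp
lemma lift23_R (z : K) (h1 : z - 1 ≠ 0) (h2 : z * r - s ≠ 0) (h3 : z - nExp n ≠ 0) : lift23 n (Rbar n z) = cf z • (p2 n * L2 (X4 n z)) := by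
  ext ⟨a, b, c⟩ ⟨x, y, t⟩
  rw [Matrix.smul_apply, p2_mul, lift23_eq]
  simp only [L2, Matrix.of_apply, Rb z h1 h2 h3 c b, cf]
  split_ifs <;> simp

lemma good (P : MvPolynomial (Fin 4) ℚ) (h : MvPolynomial.eval ![1,1,2,2] P - 1 ≠ 0) :
    algebraMap _ K P - 1 ≠ 0 ∧ algebraMap _ K P * r - s ≠ 0 ∧ algebraMap _ K P - nExp n ≠ 0 := by
  refine ⟨?_, ?_, ?_⟩
  · rw [← map_one (algebraMap (MvPolynomial (Fin 4) ℚ) K), ← map_sub]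
    exact alg_ne ![1,1,2,2] (by simpa using h)
  · unfold r s ρ σ'
    rw [← map_pow, ← map_pow, ← map_mul, ← map_sub]
    exact alg_ne ![1,1,2,2] (by simpa using h)
  · have hr : r ≠ 0 := pow_ne_zero 2 rho_ne
    have : nExp n = s^(n+1) / r^(n+1) := by
      unfold nExp
      rw [show (-(n:ℤ)-1) = -(((n+1:ℕ)):ℤ) by push_cast; ring, show ((n:ℤ)+1) = ((n+1:ℕ):ℤ) by push_cast; ring, zpow_neg, zpow_natCast, zpow_natCast, div_eq_mul_inv, mul_comm]
    rw [this]
    intro h0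
    have h1 : algebraMap _ K P * r^(n+1) - s^(n+1) = 0 := by
      have : r^(n+1) ≠ 0 := pow_ne_zero _ hr
      field_simp at h0
      rw [h0, mul_zero]
    revert h1
    unfold r s ρ σ'
    rw [← map_pow, ← map_pow, ← map_pow, ← map_pow, ← map_mul, ← map_sub]
    exact alg_ne ![1,1,2,2] (by simpa using h)

lemma m_ne : qK - qK⁻¹ ≠ 0 := by
  have hx := rho_ne
  have hy := sig_ne
  have : ρ^2 - σ'^2 ≠ 0 := by
    unfold ρ σ'
    rw [← map_pow, ← map_pow, ← map_sub]
    exact alg_ne ![2,1,2,2] (by simp; norm_num)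
  intro h
  apply this
  unfold qK at h
  field_simp at h
  rw [h, mul_zero]

lemma nExp_ne : nExp n ≠ 0 := by
  unfold nExp
  exact mul_ne_zero (zpow_ne_zero _ (pow_ne_zero 2 rho_ne)) (zpow_ne_zero _ (pow_ne_zero 2 sig_ne))

theorem final (n : ℕ) :
    lift12 n (Rbar n zVar) * lift13 n (Rbar n (zVar * wVar)) * lift23 n (Rbar n wVar) =
    lift23 n (Rbar n wVar) * lift13 n (Rbar n (zVar * wVar)) * lift12 n (Rbar n zVar) := by
  obtain ⟨z1, z2, z3⟩ := good (n := n) (MvPolynomial.X 2) (by simp; norm_num)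
  obtain ⟨w1, w2, w3⟩ := good (n := n) (MvPolynomial.X 3) (by simp; norm_num)
  obtain ⟨v1, v2, v3⟩ := good (n := n) (MvPolynomial.X 2 * MvPolynomial.X 3) (by simp; norm_num)
  rw [map_mul] at v1 v2 v3
  change zVar - 1 ≠ 0 at z1
  change zVar * r - s ≠ 0 at z2
  change zVar - nExp n ≠ 0 at z3
  change wVar - 1 ≠ 0 at w1
  change wVar * r - s ≠ 0 at w2
  change wVar - nExp n ≠ 0 at w3
  change zVar * wVar - 1 ≠ 0 at v1
  change zVar * wVar * r - s ≠ 0 at v2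
  change zVar * wVar - nExp n ≠ 0 at v3
  have hb := baxter qK (nExp n) q_ne m_ne nExp_ne (bmw n) zVar wVar z1 w1 v1 z3 w3 v3
  simp only [← L1X, ← L2X] at hb
  unfold lift13
  rw [lift12_R _ z1 z2 z3, lift12_R _ v1 v2 v3, lift23_R _ w1 w2 w3]
  have hP2 : lift23 n (Pmat n) = p2 n := rfl
  rw [hP2]
  generalize hA : X4 n zVar = A at *
  generalize hB : X4 n (zVar * wVar) = B at *
  generalize hC : X4 n wVar = C at *
  have e1 : (p1 n * L1 A) * (p2 n * (p1 n * L1 B) * p2 n) * (p2 n * L2 C) = p1 n * p2 n * p1 n * (L2 A * L1 B * L2 C) := by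
    calc _ = p1 n * (L1 A * p2 n * p1 n) * L1 B * (p2 n * p2 n) * L2 C := by simp only [mul_assoc]
      _ = _ := by rw [L1pp, p2p2]; simp only [mul_assoc, one_mul, mul_one]
  have e2 : (p2 n * L2 C) * (p2 n * (p1 n * L1 B) * p2 n) * (p1 n * L1 A) = p2 n * p1 n * p2 n * (L1 C * L2 B * L1 A) := by
    calc _ = p2 n * L2 C * p2 n * p1 n * (L1 B * p2 n * p1 n) * L1 A := by simp only [mul_assoc]
      _ = p2 n * L2 C * (p2 n * p1 n * p2 n) * p1 n * L2 B * L1 A := by rw [L1pp]; simp only [mul_assoc]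
      _ = p2 n * (L2 C * p1 n * p2 n) * (p1 n * p1 n) * L2 B * L1 A := by rw [← pbraid]; simp only [mul_assoc]
      _ = _ := by rw [L2pp, p1p1]; simp only [mul_assoc, one_mul, mul_one]
  simp only [smul_mul_assoc, mul_smul_comm, smul_smul]
  rw [e1, e2, hb, pbraid]
  congr 1
  ring1
end YB

/-- the quantum Yang–Baxter equation for the affine `R`-matrix. -/
theorem stmt8 (n : ℕ) (hn : 2 ≤ n) :
    lift12 n (Rbar n zVar) * lift13 n (Rbar n (zVar * wVar)) * lift23 n (Rbar n wVar)
      = lift23 n (Rbar n wVar) * lift13 n (Rbar n (zVar * wVar)) * lift12 n (Rbar n zVar) := YB.final n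

end
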